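/- arXiv:1405.1187 — 3 statements merged into one kernel-verified Lean document; each statement's English description precedes it below -/
import Mathlib

section
/- For every n ≥ 1 and all real Q, Q' ≥ 1, if A, B ⊆ F_{Q,Q'} are finite sets of positive rationals, then |A/B| ≥ |A||B| / ((4T)^{n+1} (QQ')^{1/n} (1 + log(QQ'))), where T = max_{m ≤ QQ'} τ(m) and F_{Q,Q'} = {q/q' : 1 ≤ q ≤ Q, 1 ≤ q' ≤ Q'}. -/
open scoped Pointwise

/-- The set `F_{Q,Q'} = {q/q' : 1 ≤ q ≤ Q, 1 ≤ q' ≤ Q', q, q' positive integers}`. -/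
def farey (Q Q' : ℝ) : Set ℚ :=
  {z : ℚ | ∃ q q' : ℕ, 1 ≤ q ∧ (q : ℝ) ≤ Q ∧ 1 ≤ q' ∧ (q' : ℝ) ≤ Q' ∧ z = (q : ℚ) / (q' : ℚ)}

/-- `T(x) = max_{1 ≤ m ≤ x} τ(m)`. -/
noncomputable def Tmax (x : ℝ) : ℕ := (Finset.Icc 1 ⌊x⌋₊).sup (fun m => m.divisors.card)

namespace KeyAux

/-- Lowest-terms bounds. -/
def good (Q Q' : ℝ) (z : ℚ) : Prop :=
  0 < z ∧ (z.num.natAbs : ℝ) ≤ Q ∧ (z.den : ℝ) ≤ Q'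

lemma num_pos' {z : ℚ} (hz : 0 < z) : 0 < z.num.natAbs := by
  have := Rat.num_pos.mpr hz
  omega

lemma eq_div {z : ℚ} (hz : 0 < z) : z = (z.num.natAbs : ℚ) / (z.den : ℚ) := by
  have h := Rat.num_div_den z
  have h2 : ((z.num.natAbs : ℤ)) = z.num := by
    have := Rat.num_pos.mpr hz
    omega
  have h3 : ((z.num.natAbs : ℚ)) = (z.num : ℚ) := by rw [← h2]; simp
  rw [h3, h]

lemma num_den_of {p q : ℕ} (hq : 0 < q) (h : Nat.Coprime p q) :
    ((p : ℚ) / q).num.natAbs = p ∧ ((p : ℚ) / q).den = q := by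
  have hq' : (0 : ℤ) < q := by exact_mod_cast hq
  have h' : Nat.Coprime (p : ℤ).natAbs (q : ℤ).natAbs := by simpa using h
  have h1 := Rat.num_div_eq_of_coprime hq' h'
  have h2 := Rat.den_div_eq_of_coprime hq' h'
  push_cast at h1 h2
  constructor
  · rw [h1]; simp
  · exact_mod_cast h2

lemma good_of_farey {Q Q' : ℝ} {z : ℚ} (hz : z ∈ farey Q Q') : good Q Q' z := by
  obtain ⟨q, q', h1, h2, h3, h4, rfl⟩ := hz
  have hpos : (0 : ℚ) < (q : ℚ) / q' := by positivity
  have e : (q : ℚ) / q' = ((q / q.gcd q' : ℕ) : ℚ) / ((q' / q.gcd q' : ℕ) : ℚ) := by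
    have hg : 0 < q.gcd q' := Nat.gcd_pos_of_pos_left _ h1
    have hg' : ((q.gcd q' : ℕ) : ℚ) ≠ 0 := by positivity
    rw [Nat.cast_div (Nat.gcd_dvd_left _ _) hg', Nat.cast_div (Nat.gcd_dvd_right _ _) hg']
    field_simp
  have hg : 0 < q.gcd q' := Nat.gcd_pos_of_pos_left _ h1
  have := num_den_of (Nat.div_pos (Nat.le_of_dvd h3 (Nat.gcd_dvd_right q q')) hg)
    (Nat.coprime_div_gcd_div_gcd hg)
  refine ⟨hpos, ?_, ?_⟩
  · rw [e, this.1]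
    exact le_trans (by exact_mod_cast Nat.div_le_self _ _) h2
  · rw [e, this.2]
    exact le_trans (by exact_mod_cast Nat.div_le_self _ _) h4

lemma tau_le {x : ℝ} {m : ℕ} (h0 : 0 < m) (h : (m : ℝ) ≤ x) : m.divisors.card ≤ Tmax x := by
  unfold Tmax
  exact Finset.le_sup (f := fun m : ℕ => m.divisors.card)
    (Finset.mem_Icc.mpr ⟨h0, Nat.le_floor h⟩)

/-- numerator gcd -/
def g1 (a b : ℚ) : ℕ := a.num.natAbs.gcd b.num.natAbs
/-- denominator gcd -/
def g2 (a b : ℚ) : ℕ := a.den.gcd b.den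

/-- The set of pairs with product at most `X`. -/
noncomputable def G (X : ℝ) : Finset (ℕ × ℕ) :=
  ((Finset.Icc 1 ⌊X⌋₊).sigma fun i => Finset.Icc 1 ⌊X / i⌋₊).image fun p => (p.1, p.2)

lemma mem_G {X : ℝ} {p : ℕ × ℕ} (h1 : 0 < p.1) (h2 : 0 < p.2) (h : ((p.1 * p.2 : ℕ) : ℝ) ≤ X) :
    p ∈ G X := by
  unfold G
  rw [Finset.mem_image]
  refine ⟨⟨p.1, p.2⟩, ?_, rfl⟩
  have h1' : (0 : ℝ) < p.1 := by exact_mod_cast h1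
  have h2' : (1 : ℝ) ≤ p.2 := by exact_mod_cast h2
  push_cast at h
  simp only [Finset.mem_sigma, Finset.mem_Icc]
  refine ⟨⟨h1, Nat.le_floor ?_⟩, h2, Nat.le_floor ?_⟩
  · nlinarith
  · rw [le_div_iff₀ h1']; linarith

lemma card_G {X : ℝ} (hX : 1 ≤ X) : ((G X).card : ℝ) ≤ X * (1 + Real.log X) := by
  have h1 : (G X).card ≤ ∑ i ∈ Finset.Icc 1 ⌊X⌋₊, ⌊X / i⌋₊ := by
    refine Finset.card_image_le.trans ?_
    rw [Finset.card_sigma]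
    simp
  have h2 := harmonic_floor_le_one_add_log X hX
  calc ((G X).card : ℝ) ≤ ((∑ i ∈ Finset.Icc 1 ⌊X⌋₊, ⌊X / i⌋₊ : ℕ) : ℝ) := by exact_mod_cast h1
    _ ≤ ∑ i ∈ Finset.Icc 1 ⌊X⌋₊, X * (i : ℝ)⁻¹ := by
        push_cast
        refine Finset.sum_le_sum fun i _ => ?_
        rw [← div_eq_mul_inv]
        exact Nat.floor_le (by positivity)
    _ = X * (harmonic ⌊X⌋₊ : ℝ) := by
        rw [← Finset.mul_sum, harmonic_eq_sum_Icc]; push_cast; rfl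
    _ ≤ _ := by gcongr

lemma g1_pos {a b : ℚ} (ha : 0 < a) : 0 < g1 a b := Nat.gcd_pos_of_pos_left _ (num_pos' ha)
lemma g2_pos {a b : ℚ} : 0 < g2 a b := Nat.gcd_pos_of_pos_left _ a.den_pos

lemma quot_num_den {a b : ℚ} (ha : 0 < a) (hb : 0 < b) :
    (a / b).num.natAbs = (a.num.natAbs / g1 a b) * (b.den / g2 a b) ∧
    (a / b).den = (a.den / g2 a b) * (b.num.natAbs / g1 a b) := by
  have h1 := g1_pos (b := b) ha
  have h2 := g2_pos (a := a) (b := b)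
  have da1 : g1 a b ∣ a.num.natAbs := Nat.gcd_dvd_left _ _
  have db1 : g1 a b ∣ b.num.natAbs := Nat.gcd_dvd_right _ _
  have da2 : g2 a b ∣ a.den := Nat.gcd_dvd_left _ _
  have db2 : g2 a b ∣ b.den := Nat.gcd_dvd_right _ _
  have cop : Nat.Coprime ((a.num.natAbs / g1 a b) * (b.den / g2 a b))
      ((a.den / g2 a b) * (b.num.natAbs / g1 a b)) := by
    have c1 : Nat.Coprime (a.num.natAbs / g1 a b) (a.den / g2 a b) :=
      Nat.Coprime.coprime_dvd_left (Nat.div_dvd_of_dvd da1)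
        (Nat.Coprime.coprime_dvd_right (Nat.div_dvd_of_dvd da2) a.reduced)
    have c2 : Nat.Coprime (b.num.natAbs / g1 a b) (b.den / g2 a b) :=
      Nat.Coprime.coprime_dvd_left (Nat.div_dvd_of_dvd db1)
        (Nat.Coprime.coprime_dvd_right (Nat.div_dvd_of_dvd db2) b.reduced)
    have c3 : Nat.Coprime (a.num.natAbs / g1 a b) (b.num.natAbs / g1 a b) :=
      Nat.coprime_div_gcd_div_gcd h1
    have c4 : Nat.Coprime (a.den / g2 a b) (b.den / g2 a b) :=
      Nat.coprime_div_gcd_div_gcd h2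
    exact Nat.Coprime.mul_left (Nat.Coprime.mul_right c1 c3) (Nat.Coprime.mul_right c4.symm c2.symm)
  have e : a / b = (((a.num.natAbs / g1 a b) * (b.den / g2 a b) : ℕ) : ℚ) /
      (((a.den / g2 a b) * (b.num.natAbs / g1 a b) : ℕ) : ℚ) := by
    have h1' : ((g1 a b : ℕ) : ℚ) ≠ 0 := by positivity
    have h2' : ((g2 a b : ℕ) : ℚ) ≠ 0 := by positivity
    have n1 : ((a.num.natAbs : ℕ) : ℚ) ≠ 0 := by have := num_pos' ha; positivity
    have n2 : ((b.num.natAbs : ℕ) : ℚ) ≠ 0 := by have := num_pos' hb; positivity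
    have n3 : ((a.den : ℕ) : ℚ) ≠ 0 := by have := a.den_pos; positivity
    have n4 : ((b.den : ℕ) : ℚ) ≠ 0 := by have := b.den_pos; positivity
    rw [Nat.cast_mul, Nat.cast_mul, Nat.cast_div da1 h1', Nat.cast_div da2 h2',
      Nat.cast_div db1 h1', Nat.cast_div db2 h2']
    conv_lhs => rw [eq_div ha, eq_div hb]
    generalize ((a.num.natAbs : ℕ) : ℚ) = x at *
    generalize ((b.num.natAbs : ℕ) : ℚ) = y at *
    field_simp
  have hpos : 0 < (a.den / g2 a b) * (b.num.natAbs / g1 a b) :=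
    Nat.mul_pos (Nat.div_pos (Nat.le_of_dvd a.den_pos da2) h2)
      (Nat.div_pos (Nat.le_of_dvd (num_pos' hb) db1) h1)
  have := num_den_of hpos cop
  rw [e]
  exact this

/-- Few pairs with small gcd have a given quotient. -/
lemma fiber_card {Q Q' X : ℝ} (hQ : 1 ≤ Q) (hQ' : 1 ≤ Q') (S : Finset (ℚ × ℚ)) (c : ℚ)
    (hS : ∀ p ∈ S, good Q Q' p.1 ∧ good Q Q' p.2 ∧ ((g1 p.1 p.2 * g2 p.1 p.2 : ℕ) : ℝ) ≤ X ∧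
      p.1 / p.2 = c) :
    S.card ≤ Tmax (Q * Q') ^ 2 * (G X).card := by
  rcases S.eq_empty_or_nonempty with rfl | ⟨p, hp⟩
  · simp
  obtain ⟨pa, pb, -, hc⟩ := hS p hp
  have hcpos : 0 < c := hc ▸ div_pos pa.1 pb.1
  have hu : c.num.natAbs.divisors.card ≤ Tmax (Q * Q') := by
    apply tau_le (num_pos' hcpos)
    rw [← hc, (quot_num_den pa.1 pb.1).1, Nat.cast_mul]
    have h1 : ((p.1.num.natAbs / g1 p.1 p.2 : ℕ) : ℝ) ≤ Q :=
      le_trans (by exact_mod_cast Nat.div_le_self _ _) pa.2.1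
    have h2 : ((p.2.den / g2 p.1 p.2 : ℕ) : ℝ) ≤ Q' :=
      le_trans (by exact_mod_cast Nat.div_le_self _ _) pb.2.2
    gcongr
  have hv : c.den.divisors.card ≤ Tmax (Q * Q') := by
    apply tau_le c.den_pos
    rw [← hc, (quot_num_den pa.1 pb.1).2, Nat.cast_mul, mul_comm]
    have h1 : ((p.2.num.natAbs / g1 p.1 p.2 : ℕ) : ℝ) ≤ Q :=
      le_trans (by exact_mod_cast Nat.div_le_self _ _) pb.2.1
    have h2 : ((p.1.den / g2 p.1 p.2 : ℕ) : ℝ) ≤ Q' :=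
      le_trans (by exact_mod_cast Nat.div_le_self _ _) pa.2.2
    gcongr
  have hinj : S.card ≤ ((c.num.natAbs.divisors ×ˢ c.den.divisors) ×ˢ G X).card := by
    apply Finset.card_le_card_of_injOn
      (fun p => ((p.1.num.natAbs / g1 p.1 p.2, p.1.den / g2 p.1 p.2), (g1 p.1 p.2, g2 p.1 p.2)))
    · intro q hq
      obtain ⟨qa, qb, hX, hqc⟩ := hS q hq
      have hh := quot_num_den qa.1 qb.1
      rw [hqc] at hh
      simp only [Finset.coe_product, Set.mem_prod, Finset.mem_coe, Nat.mem_divisors]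
      refine ⟨⟨⟨⟨_, hh.1⟩, (num_pos' hcpos).ne'⟩, ⟨⟨_, hh.2⟩, c.den_pos.ne'⟩⟩, ?_⟩
      exact mem_G (g1_pos qa.1) g2_pos hX
    · intro q hq r hr heq
      obtain ⟨qa, qb, -, hqc⟩ := hS q hq
      obtain ⟨ra, rb, -, hrc⟩ := hS r hr
      simp only [Prod.mk.injEq] at heq
      obtain ⟨⟨e1, e2⟩, e3, e4⟩ := heq
      have n1 : q.1.num.natAbs = r.1.num.natAbs := by
        rw [← Nat.div_mul_cancel (show g1 q.1 q.2 ∣ q.1.num.natAbs from Nat.gcd_dvd_left _ _),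
          ← Nat.div_mul_cancel (show g1 r.1 r.2 ∣ r.1.num.natAbs from Nat.gcd_dvd_left _ _), e1, e3]
      have n2 : q.1.den = r.1.den := by
        rw [← Nat.div_mul_cancel (show g2 q.1 q.2 ∣ q.1.den from Nat.gcd_dvd_left _ _),
          ← Nat.div_mul_cancel (show g2 r.1 r.2 ∣ r.1.den from Nat.gcd_dvd_left _ _), e2, e4]
      have f1 : q.1 = r.1 := by rw [eq_div qa.1, eq_div ra.1, n1, n2]
      have f2 : q.2 = r.2 := by
        have hq2 := qb.1.ne'
        have hr2 := rb.1.ne'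
        rw [div_eq_iff hq2] at hqc
        rw [div_eq_iff hr2] at hrc
        have : c * q.2 = c * r.2 := by rw [← hqc, ← hrc, f1]
        exact mul_left_cancel₀ hcpos.ne' this
      exact Prod.ext f1 f2
  refine hinj.trans ?_
  rw [Finset.card_product, Finset.card_product, sq]
  gcongr

/-- Dividing out a common gcd. -/
lemma div_good {Q Q' : ℝ} {b : ℚ} (hb : good Q Q' b) {d1 d2 : ℕ} (h1 : d1 ∣ b.num.natAbs)
    (h2 : d2 ∣ b.den) :
    good Q Q' (b / ((d1 : ℚ) / d2)) ∧
    (b / ((d1 : ℚ) / d2)).num.natAbs * (b / ((d1 : ℚ) / d2)).den * (d1 * d2)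
      = b.num.natAbs * b.den := by
  have p1 : 0 < d1 := Nat.pos_of_dvd_of_pos h1 (num_pos' hb.1)
  have p2 : 0 < d2 := Nat.pos_of_dvd_of_pos h2 b.den_pos
  have p1' : (d1 : ℚ) ≠ 0 := by positivity
  have p2' : (d2 : ℚ) ≠ 0 := by positivity
  have e : b / ((d1 : ℚ) / d2) = ((b.num.natAbs / d1 : ℕ) : ℚ) / ((b.den / d2 : ℕ) : ℚ) := by
    rw [Nat.cast_div h1 p1', Nat.cast_div h2 p2']
    conv_lhs => rw [eq_div hb.1]
    have n4 : ((b.den : ℕ) : ℚ) ≠ 0 := by have := b.den_pos; positivity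
    generalize ((b.num.natAbs : ℕ) : ℚ) = y at *
    field_simp
  have := num_den_of (p := b.num.natAbs / d1) (q := b.den / d2)
    (Nat.div_pos (Nat.le_of_dvd b.den_pos h2) p2)
    (Nat.Coprime.coprime_dvd_left (Nat.div_dvd_of_dvd h1)
        (Nat.Coprime.coprime_dvd_right (Nat.div_dvd_of_dvd h2) b.reduced))
  rw [← e] at this
  refine ⟨⟨div_pos hb.1 (by positivity), ?_, ?_⟩, ?_⟩
  · rw [this.1]; exact le_trans (by exact_mod_cast Nat.div_le_self _ _) hb.2.1
  · rw [this.2]; exact le_trans (by exact_mod_cast Nat.div_le_self _ _) hb.2.2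
  · rw [this.1, this.2]
    calc _ = (b.num.natAbs / d1 * d1) * (b.den / d2 * d2) := by ring
      _ = _ := by rw [Nat.div_mul_cancel h1, Nat.div_mul_cancel h2]

lemma main_ind {Q Q' X L : ℝ} (hQ : 1 ≤ Q) (hQ' : 1 ≤ Q') (hX : 1 ≤ X)
    (hL : Real.log X ≤ L) (A : Finset ℚ) (hA : ∀ a ∈ A, good Q Q' a) (k : ℕ) :
    ∀ B : Finset ℚ, (∀ b ∈ B, good Q Q' b ∧ ((b.num.natAbs * b.den : ℕ) : ℝ) ≤ X ^ k) →
    (A.card : ℝ) * B.card ≤ (4 * (Tmax (Q * Q') : ℝ)) ^ (k + 1) * X * (1 + L) * (A / B).card := by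
  have hT1 : (1 : ℝ) ≤ Tmax (Q * Q') := by
    have := tau_le (x := Q * Q') (m := 1) one_pos (by push_cast; nlinarith)
    simp at this
    exact_mod_cast this
  have hL0 : 0 ≤ L := (Real.log_nonneg hX).trans hL
  set T : ℝ := (Tmax (Q * Q') : ℝ) with hT
  induction k with
  | zero =>
    intro B hB
    have hsub : B ⊆ {1} := by
      intro b hb
      obtain ⟨h1, h2⟩ := hB b hb
      have h3 : b.num.natAbs * b.den ≤ 1 := by
        rw [pow_zero] at h2; exact_mod_cast h2
      have h4 := num_pos' h1.1
      have h5 := b.den_pos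
      have h6 : b.num.natAbs = 1 := by nlinarith
      have h7 : b.den = 1 := by nlinarith
      have := eq_div h1.1
      rw [h6, h7] at this
      simp [this]
    have hone : 1 ≤ (4 * T) ^ (0 + 1) * X * (1 + L) := by
      have : 1 ≤ (4 * T) ^ (0 + 1) := by norm_num; linarith
      exact one_le_mul_of_one_le_of_one_le (one_le_mul_of_one_le_of_one_le this hX) (by linarith)
    rcases Finset.subset_singleton_iff.mp hsub with rfl | rfl
    · simp
    · have : A / {1} = A := by ext x; simp [Finset.mem_div]
      rw [this]
      simp only [Finset.card_singleton, Nat.cast_one, mul_one]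
      exact le_mul_of_one_le_left (by positivity) hone
  | succ k ih =>
    intro B hB
    classical
    set S := (A ×ˢ B).filter (fun p => ((g1 p.1 p.2 * g2 p.1 p.2 : ℕ) : ℝ) ≤ X) with hS
    by_cases hbig : (A.card : ℝ) * B.card ≤ 2 * S.card
    · -- many pairs with small gcd
      have hfib : S.card ≤ Tmax (Q * Q') ^ 2 * (G X).card * (S.image fun p => p.1 / p.2).card := by
        apply Finset.card_le_mul_card_image
        intro c _
        apply fiber_card hQ hQ' _ c
        intro p hp
        simp only [hS, Finset.mem_filter, Finset.mem_product] at hp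
        exact ⟨hA _ hp.1.1.1, (hB _ hp.1.1.2).1, hp.1.2, hp.2⟩
      have himg : (S.image fun p => p.1 / p.2).card ≤ (A / B).card := by
        apply Finset.card_le_card
        intro c hc
        obtain ⟨p, hp, rfl⟩ := Finset.mem_image.mp hc
        simp only [hS, Finset.mem_filter, Finset.mem_product] at hp
        exact Finset.div_mem_div hp.1.1 hp.1.2
      have h1 : (S.card : ℝ) ≤ T ^ 2 * (G X).card * (A / B).card := by
        have := hfib.trans (Nat.mul_le_mul_left _ himg)
        rw [hT]; exact_mod_cast this
      have h2 := card_G hX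
      have h3 : 2 * T ^ 2 ≤ (4 * T) ^ (k + 1 + 1) := by
        calc 2 * T ^ 2 ≤ (4 * T) ^ 2 := by nlinarith
          _ ≤ _ := pow_le_pow_right₀ (by linarith) (by omega)
      calc (A.card : ℝ) * B.card ≤ 2 * S.card := hbig
        _ ≤ 2 * (T ^ 2 * (G X).card * (A / B).card) := by linarith
        _ ≤ 2 * (T ^ 2 * (X * (1 + L)) * (A / B).card) := by
            have : ((G X).card : ℝ) ≤ X * (1 + L) := h2.trans (by gcongr)
            gcongr
        _ = (2 * T ^ 2) * X * (1 + L) * (A / B).card := by ring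
        _ ≤ _ := by gcongr
    · push Not at hbig
      -- some `a` has many `b` with large gcd
      let R : ℚ → Finset ℚ := fun a => B.filter (fun b => X < ((g1 a b * g2 a b : ℕ) : ℝ))
      have hsum : S.card + ∑ a ∈ A, (R a).card = A.card * B.card := by
        rw [← Finset.card_product, ← Finset.card_filter_add_card_filter_not
          (s := A ×ˢ B) (fun p => ((g1 p.1 p.2 * g2 p.1 p.2 : ℕ) : ℝ) ≤ X)]
        congr 1
        rw [Finset.card_filter, Finset.sum_product]
        refine Finset.sum_congr rfl fun a _ => ?_
        rw [Finset.card_filter]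
        simp only [not_le]
      have hex : ∃ a ∈ A, (B.card : ℝ) ≤ 2 * (R a).card := by
        by_contra! hcon
        have h1 : ∑ a ∈ A, (2 * (R a).card : ℝ) ≤ ∑ a ∈ A, (B.card : ℝ) :=
          Finset.sum_le_sum fun a ha => (hcon a ha).le
        rw [← Finset.mul_sum, Finset.sum_const, nsmul_eq_mul] at h1
        have h2 : (S.card : ℝ) + ∑ a ∈ A, ((R a).card : ℝ) = A.card * B.card := by
          exact_mod_cast hsum
        linarith
      obtain ⟨a, ha, hRa⟩ := hex
      have hag := hA a ha
      -- pigeonhole on the gcd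
      set D := a.num.natAbs.divisors ×ˢ a.den.divisors with hD
      have hDT : (D.card : ℝ) ≤ T := by
        rw [hD, Finset.card_product, ← Nat.Coprime.card_divisors_mul a.reduced, hT]
        have hle : ((a.num.natAbs * a.den : ℕ) : ℝ) ≤ Q * Q' := by
          push_cast [-Nat.cast_natAbs]
          have h1 := hag.2.1
          have h2 := hag.2.2
          gcongr
        exact_mod_cast tau_le (Nat.mul_pos (num_pos' hag.1) a.den_pos) hle
      let F : ℕ × ℕ → Finset ℚ := fun d => (R a).filter (fun b => (g1 a b, g2 a b) = d)
      have hcard : (R a).card = ∑ d ∈ D, (F d).card := by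
        apply Finset.card_eq_sum_card_fiberwise
        intro b _
        simp only [hD, Finset.coe_product, Set.mem_prod, Finset.mem_coe, Nat.mem_divisors]
        exact ⟨⟨Nat.gcd_dvd_left _ _, (num_pos' hag.1).ne'⟩, Nat.gcd_dvd_left _ _, a.den_pos.ne'⟩
      have hDne : D.Nonempty := ⟨(1, 1), by
        simp [hD, hag.1.ne', a.den_pos.ne']⟩
      have hex2 : ∃ d ∈ D, ((R a).card : ℝ) ≤ T * (F d).card := by
        by_contra! hcon
        have h1 : ∑ d ∈ D, (T * (F d).card : ℝ) < ∑ d ∈ D, ((R a).card : ℝ) :=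
          Finset.sum_lt_sum_of_nonempty hDne hcon
        rw [← Finset.mul_sum, Finset.sum_const, nsmul_eq_mul] at h1
        have h2 : ((R a).card : ℝ) = ∑ d ∈ D, ((F d).card : ℝ) := by exact_mod_cast hcard
        rw [← h2] at h1
        have : (D.card : ℝ) * (R a).card ≤ T * (R a).card := by gcongr
        linarith
      obtain ⟨⟨d1, d2⟩, hd, hF⟩ := hex2
      have hdp : 0 < d1 ∧ 0 < d2 := by
        simp only [hD, Finset.mem_product, Nat.mem_divisors] at hd
        exact ⟨Nat.pos_of_dvd_of_pos hd.1.1 (num_pos' hag.1),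
          Nat.pos_of_dvd_of_pos hd.2.1 a.den_pos⟩
      obtain ⟨hd1, hd2⟩ := hdp
      have hd0 : ((d1 : ℚ) / d2) ≠ 0 := by positivity
      set B' := (F (d1, d2)).image (fun b => b / ((d1 : ℚ) / d2)) with hB'
      have hB'card : B'.card = (F (d1, d2)).card := by
        apply Finset.card_image_of_injective
        intro x y hxy
        exact (div_left_inj' hd0).mp hxy
      have hB'h : ∀ b ∈ B', good Q Q' b ∧ ((b.num.natAbs * b.den : ℕ) : ℝ) ≤ X ^ k := by
        intro b' hb'
        obtain ⟨b, hb, rfl⟩ := Finset.mem_image.mp hb'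
        simp only [F, R, Finset.mem_filter, Prod.mk.injEq] at hb
        obtain ⟨⟨hbB, hbX⟩, e1, e2⟩ := hb
        have k1 : d1 ∣ b.num.natAbs := e1 ▸ Nat.gcd_dvd_right _ _
        have k2 : d2 ∣ b.den := e2 ▸ Nat.gcd_dvd_right _ _
        obtain ⟨hg, hh⟩ := div_good (hB b hbB).1 k1 k2
        refine ⟨hg, ?_⟩
        have hle := (hB b hbB).2
        rw [← hh, Nat.cast_mul, pow_succ] at hle
        rw [e1, e2] at hbX
        have hX0 : 0 < X := by linarith
        refine le_of_mul_le_mul_right (le_trans ?_ hle) hX0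
        gcongr
      have hsub : (A / B').card ≤ (A / B).card := by
        have : A / B' ⊆ (A / B).image (fun x => x * ((d1 : ℚ) / d2)) := by
          intro x hx
          obtain ⟨y, hy, z, hz, rfl⟩ := Finset.mem_div.mp hx
          obtain ⟨b, hb, rfl⟩ := Finset.mem_image.mp hz
          simp only [F, R, Finset.mem_filter] at hb
          refine Finset.mem_image.mpr ⟨y / b, Finset.div_mem_div hy hb.1.1, ?_⟩
          rw [div_div_eq_mul_div, div_mul_eq_mul_div]
        exact (Finset.card_le_card this).trans Finset.card_image_le
      have hI := ih B' hB'h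
      rw [hB'card] at hI
      have hsub' : ((A / B').card : ℝ) ≤ (A / B).card := by exact_mod_cast hsub
      have hBF : (B.card : ℝ) ≤ 4 * T * (F (d1, d2)).card := by
        have : 0 ≤ T * ((F (d1, d2)).card : ℝ) := by positivity
        linarith
      calc (A.card : ℝ) * B.card ≤ A.card * (4 * T * (F (d1, d2)).card) := by gcongr
        _ = 4 * T * (A.card * (F (d1, d2)).card) := by ring
        _ ≤ 4 * T * ((4 * T) ^ (k + 1) * X * (1 + L) * (A / B').card) := by gcongr
        _ ≤ 4 * T * ((4 * T) ^ (k + 1) * X * (1 + L) * (A / B).card) := by gcongr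
        _ = _ := by ring

end KeyAux

/-- Key Lemma: for any `n ≥ 1` and `A, B ⊆ F_{Q,Q'}`,
`|A/B| ≥ |A||B| / ((4T)^{n+1} (QQ')^{1/n} (1 + log(QQ')))` with `T = max_{m ≤ QQ'} τ(m)`. -/
theorem key_lemma (n : ℕ) (hn : 1 ≤ n) (Q Q' : ℝ) (hQ : 1 ≤ Q) (hQ' : 1 ≤ Q')
    (A B : Finset ℚ) (hA : ↑A ⊆ farey Q Q') (hB : ↑B ⊆ farey Q Q') :
    (A.card : ℝ) * B.card /
        ((4 * (Tmax (Q * Q') : ℝ)) ^ (n + 1) * (Q * Q') ^ ((1 : ℝ) / n) *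
          (1 + Real.log (Q * Q')))
      ≤ ((A / B).card : ℝ) := by
  have hQQ : 1 ≤ Q * Q' := by nlinarith
  have hn' : (1 : ℝ) ≤ n := by exact_mod_cast hn
  have hX : 1 ≤ (Q * Q') ^ ((1 : ℝ) / n) := Real.one_le_rpow hQQ (by positivity)
  have hXn : ((Q * Q') ^ ((1 : ℝ) / n)) ^ n = Q * Q' := by
    rw [one_div]
    exact Real.rpow_inv_natCast_pow (by linarith) (by omega)
  have hL : Real.log ((Q * Q') ^ ((1 : ℝ) / n)) ≤ Real.log (Q * Q') := by
    rw [Real.log_rpow (by linarith)]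
    have h0 := Real.log_nonneg hQQ
    have : (1 : ℝ) / n ≤ 1 := by rw [div_le_one (by linarith)]; exact hn'
    nlinarith
  have h0 := Real.log_nonneg hQQ
  apply div_le_of_le_mul₀ (by positivity) (by positivity)
  rw [mul_comm ((A / B).card : ℝ)]
  apply KeyAux.main_ind hQ hQ' hX hL A (fun a ha => KeyAux.good_of_farey (hA ha)) n B
  intro b hb
  have hg := KeyAux.good_of_farey (hB hb)
  refine ⟨hg, ?_⟩
  rw [hXn, Nat.cast_mul]
  have h1 := hg.2.1
  have h2 := hg.2.2
  gcongr
end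

section
/- If A, B ⊆ F_{Q,Q'} with Q, Q' ≥ 1 real, then |A/B| ≥ |A||B| · exp(−(2√(log 2) + o(1)) · log(QQ') / √(log log(QQ'))), where o(1) → 0 as QQ' → ∞. More precisely: for every ε > 0 there exists C such that for all QQ' ≥ C and all A, B ⊆ F_{Q,Q'}, |A/B| ≥ |A||B| exp(−(2√(log 2) + ε) log(QQ')/√(log log(QQ'))). -/
open scoped Pointwise

theorem divisor_bound (t : ℕ) (ht : 2 ≤ t) (Y : ℝ) (m : ℕ) (hm : 1 ≤ m)
    (hY : 1 + Real.log m / Real.log 2 ≤ Y) :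
    (m.divisors.card : ℝ) ≤ Y ^ t * (m : ℝ) ^ (Real.log 2 / Real.log t) := by
  have hl2 : 0 < Real.log 2 := Real.log_pos (by norm_num)
  have hlt : 0 < Real.log t := Real.log_pos (by exact_mod_cast ht)
  set c := Real.log 2 / Real.log t with hc
  have hc0 : 0 < c := div_pos hl2 hlt
  have hlm : 0 ≤ Real.log m := Real.log_nonneg (by exact_mod_cast hm)
  have hY1 : 1 ≤ Y := le_trans (by have := div_nonneg hlm hl2.le; linarith) hY
  have hm0 : m ≠ 0 := by omega
  rw [Nat.card_divisors hm0]
  push_cast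
  have h1 : ∀ p ∈ m.primeFactors, ((m.factorization p : ℝ) + 1) ≤
      (if p < t then Y else 1) * ((p : ℝ) ^ (m.factorization p)) ^ c := by
    intro p hp
    have hpp := Nat.prime_of_mem_primeFactors hp
    have hp2 : (2:ℝ) ≤ p := by exact_mod_cast hpp.two_le
    have hpos : (0:ℝ) < p := by linarith
    split_ifs with h
    · have h2 : (1:ℝ) ≤ ((p : ℝ) ^ (m.factorization p)) ^ c :=
        Real.one_le_rpow (one_le_pow₀ (by linarith)) hc0.le
      have h3 : (m.factorization p : ℝ) + 1 ≤ Y := by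
        have h4 : (2:ℝ) ^ (m.factorization p) ≤ m := by
          have : p ^ m.factorization p ≤ m := Nat.ordProj_le p hm0
          calc (2:ℝ) ^ (m.factorization p) ≤ (p:ℝ) ^ (m.factorization p) := by gcongr
            _ ≤ m := by exact_mod_cast this
        have h5 := Real.log_le_log (by positivity) h4
        rw [Real.log_pow] at h5
        have : (m.factorization p : ℝ) ≤ Real.log m / Real.log 2 := by
          rw [le_div_iff₀ hl2]; exact h5
        linarith
      nlinarith
    · push Not at h
      have h2 : (2:ℝ) ≤ (p:ℝ) ^ c := by
        have : (t:ℝ) ^ c = 2 := by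
          rw [Real.rpow_def_of_pos (by positivity), hc, mul_div_cancel₀ _ hlt.ne',
            Real.exp_log (by norm_num)]
        rw [← this]
        exact Real.rpow_le_rpow (by positivity) (by exact_mod_cast h) hc0.le
      rw [one_mul, ← Real.rpow_natCast, ← Real.rpow_mul hpos.le, mul_comm _ c,
        Real.rpow_mul hpos.le, Real.rpow_natCast]
      calc (m.factorization p : ℝ) + 1 ≤ 2 ^ (m.factorization p) := by
            exact_mod_cast Nat.lt_two_pow_self
        _ ≤ _ := by gcongr
  calc ∏ x ∈ m.primeFactors, ((m.factorization x : ℝ) + 1)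
      ≤ ∏ p ∈ m.primeFactors, ((if p < t then Y else 1) * ((p : ℝ) ^ (m.factorization p)) ^ c) :=
        Finset.prod_le_prod (fun _ _ => by positivity) h1
    _ = (∏ p ∈ m.primeFactors, (if p < t then Y else 1)) * (m:ℝ) ^ c := by
        rw [Finset.prod_mul_distrib, Real.finsetProd_rpow _ _ (fun _ _ => by positivity)]
        congr 2
        have := Nat.prod_factorization_pow_eq_self hm0
        rw [Finsupp.prod, Nat.support_factorization] at this
        exact_mod_cast this
    _ ≤ _ := by
        gcongr
        rw [← Finset.prod_filter, Finset.prod_const]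
        apply pow_le_pow_right₀ hY1
        calc _ ≤ (Finset.range t).card := Finset.card_le_card (by
              intro p hp; simp at hp ⊢; exact hp.2)
          _ = t := by simp

def key (x : (ℕ × ℕ) × (ℕ × ℕ)) : ℚ := ((x.1.1:ℚ)/x.1.2)/((x.2.1:ℚ)/x.2.2)

def Good (M : ℝ) (a : ℕ × ℕ) : Prop :=
  0 < a.1 ∧ 0 < a.2 ∧ Nat.Coprime a.1 a.2 ∧ (a.1 * a.2 : ℝ) ≤ M

theorem key_num_den {p q r s : ℕ} (hp : 0 < p) (hq : 0 < q) (hr : 0 < r) (hs : 0 < s)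
    (h1 : Nat.Coprime p q) (h2 : Nat.Coprime r s) :
    (key ((p, q), (r, s))).num.natAbs = p / Nat.gcd p r * (s / Nat.gcd q s) ∧
    (key ((p, q), (r, s))).den = q / Nat.gcd q s * (r / Nat.gcd p r) := by
  obtain ⟨d, p', r', hd, hc, rfl, rfl⟩ := Nat.exists_coprime' (m := p) (n := r) (Nat.gcd_pos_of_pos_left _ hp)
  obtain ⟨e, q', s', he, hc', rfl, rfl⟩ := Nat.exists_coprime' (m := q) (n := s) (Nat.gcd_pos_of_pos_left _ hq)
  have hp' : 0 < p' := Nat.pos_of_mul_pos_right hp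
  have hq' : 0 < q' := Nat.pos_of_mul_pos_right hq
  have hr' : 0 < r' := Nat.pos_of_mul_pos_right hr
  have hs' : 0 < s' := Nat.pos_of_mul_pos_right hs
  rw [Nat.gcd_mul_right, hc.gcd_eq_one, Nat.gcd_mul_right, hc'.gcd_eq_one]
  simp only [one_mul, Nat.mul_div_cancel _ hd, Nat.mul_div_cancel _ he]
  have hk : key ((p' * d, q' * e), (r' * d, s' * e)) = (((p' * s' : ℕ) : ℤ) : ℚ) / (((q' * r' : ℕ) : ℤ) : ℚ) := by
    simp only [key]
    push_cast
    field_simp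
  have cop : Nat.Coprime (p' * s') (q' * r') := by
    refine Nat.Coprime.mul_left (Nat.Coprime.mul_right ?_ hc) (Nat.Coprime.mul_right hc'.symm ?_)
    · exact Nat.Coprime.coprime_mul_right_right (Nat.Coprime.coprime_mul_right h1)
    · exact (Nat.Coprime.coprime_mul_right_right (Nat.Coprime.coprime_mul_right h2)).symm
  have hb0 : (0:ℤ) < ((q' * r' : ℕ) : ℤ) := by positivity
  rw [hk]
  constructor
  · rw [Rat.num_div_eq_of_coprime hb0 (by simpa only [Int.natAbs_natCast] using cop),
      Int.natAbs_natCast]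
  · have := Rat.den_div_eq_of_coprime hb0 (a := ((p' * s' : ℕ) : ℤ)) (by simpa only [Int.natAbs_natCast] using cop)
    exact_mod_cast this

/-- height of the gcd -/
def gh (x : (ℕ × ℕ) × (ℕ × ℕ)) : ℕ := Nat.gcd x.1.1 x.2.1 * Nat.gcd x.1.2 x.2.2

theorem fiber_bound (N2 E c M H : ℝ) (hE : 1 ≤ E) (hc : 0 ≤ c) (hM : 1 ≤ M) (hMN : M * M ≤ N2)
    (hH : 1 ≤ H) (hHN : H ≤ N2)
    (hτ : ∀ m : ℕ, 1 ≤ m → (m:ℝ) ≤ N2 → (m.divisors.card : ℝ) ≤ E * (m:ℝ) ^ c)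
    (P : Finset ((ℕ × ℕ) × (ℕ × ℕ)))
    (hP : ∀ x ∈ P, Good M x.1 ∧ Good M x.2 ∧ (gh x : ℝ) ≤ H) :
    (P.card : ℝ) ≤ (E ^ 2 * M ^ (2 * c) * (E * H ^ (1 + c))) * (P.image key).card := by
  set F := (E ^ 2 * M ^ (2 * c) * (E * H ^ (1 + c))) with hF
  have hF0 : 0 ≤ F := by positivity
  have main : P.card ≤ ⌊F⌋₊ * (P.image key).card := by
    apply Finset.card_le_mul_card_image
    intro z hz
    rw [Finset.mem_image] at hz
    obtain ⟨⟨⟨p0, q0⟩, ⟨r0, s0⟩⟩, hx0, hz⟩ := hz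
    apply Nat.le_floor
    obtain ⟨⟨hp0, hq0, hpq0, hM1⟩, ⟨hr0, hs0, hrs0, hM2⟩, -⟩ := hP _ hx0
    simp only at hp0 hq0 hpq0 hM1 hr0 hs0 hrs0 hM2
    have hnd := key_num_den hp0 hq0 hr0 hs0 hpq0 hrs0
    rw [hz] at hnd
    set D := (Finset.Icc 1 ⌊H⌋₊).biUnion Nat.divisorsAntidiagonal with hD
    have hDc : (D.card : ℝ) ≤ E * H ^ (1 + c) := by
      have h1 : D.card ≤ ∑ m ∈ Finset.Icc 1 ⌊H⌋₊, m.divisors.card := by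
        refine Finset.card_biUnion_le.trans (Finset.sum_le_sum fun m _ => ?_)
        rw [← Nat.map_div_right_divisors, Finset.card_map]
      calc (D.card : ℝ) ≤ ∑ m ∈ Finset.Icc 1 ⌊H⌋₊, (m.divisors.card : ℝ) := by exact_mod_cast h1
        _ ≤ ∑ m ∈ Finset.Icc 1 ⌊H⌋₊, E * H ^ c := by
          refine Finset.sum_le_sum fun m hm => ?_
          rw [Finset.mem_Icc] at hm
          have hmH : (m:ℝ) ≤ H := (Nat.le_floor_iff (by linarith)).1 hm.2
          refine (hτ m hm.1 (hmH.trans hHN)).trans ?_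
          gcongr
        _ = ⌊H⌋₊ * (E * H ^ c) := by simp
        _ ≤ H * (E * H ^ c) := by
          gcongr
          exact Nat.floor_le (by linarith)
        _ = _ := by rw [Real.rpow_add (by linarith), Real.rpow_one]; ring
    have num_pos : 0 < z.num.natAbs := by
      rw [hnd.1]
      exact Nat.mul_pos (Nat.div_pos (Nat.gcd_le_left _ hp0) (Nat.gcd_pos_of_pos_left _ hp0))
        (Nat.div_pos (Nat.gcd_le_right _ hs0) (Nat.gcd_pos_of_pos_left _ hq0))
    have den_pos : 0 < z.den := z.den_pos
    have hnum : (z.num.natAbs : ℝ) ≤ p0 * s0 := by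
      rw [hnd.1]; push_cast
      have h1 : ((p0 / p0.gcd r0 : ℕ) : ℝ) ≤ p0 := by exact_mod_cast Nat.div_le_self _ _
      have h2 : ((s0 / q0.gcd s0 : ℕ) : ℝ) ≤ s0 := by exact_mod_cast Nat.div_le_self _ _
      gcongr
    have hden : (z.den : ℝ) ≤ q0 * r0 := by
      rw [hnd.2]; push_cast
      have h1 : ((q0 / q0.gcd s0 : ℕ) : ℝ) ≤ q0 := by exact_mod_cast Nat.div_le_self _ _
      have h2 : ((r0 / p0.gcd r0 : ℕ) : ℝ) ≤ r0 := by exact_mod_cast Nat.div_le_self _ _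
      gcongr
    have hprod : (z.num.natAbs : ℝ) * z.den ≤ M * M := by
      calc (z.num.natAbs : ℝ) * z.den ≤ (p0 * s0) * (q0 * r0) := by gcongr
        _ = (p0 * q0) * (r0 * s0) := by ring
        _ ≤ M * M := by gcongr
    have n1 : (1:ℝ) ≤ z.num.natAbs := by exact_mod_cast num_pos
    have d1 : (1:ℝ) ≤ z.den := by exact_mod_cast den_pos
    have hA := hτ z.num.natAbs num_pos (by nlinarith)
    have hB := hτ z.den den_pos (by nlinarith)
    have hAB : (z.num.natAbs.divisors.card : ℝ) * z.den.divisors.card ≤ E ^ 2 * M ^ (2 * c) := by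
      calc _ ≤ (E * (z.num.natAbs : ℝ) ^ c) * (E * (z.den : ℝ) ^ c) := by gcongr
        _ = E ^ 2 * ((z.num.natAbs : ℝ) * z.den) ^ c := by
          rw [Real.mul_rpow (by positivity) (by positivity)]; ring
        _ ≤ E ^ 2 * (M * M) ^ c := by gcongr
        _ = _ := by rw [← pow_two, Real.rpow_mul (by linarith)]; norm_num
    have hcard : (P.filter (fun x => key x = z)).card ≤
        ((z.num.natAbs.divisors ×ˢ z.den.divisors) ×ˢ D).card := by
      apply Finset.card_le_card_of_injOn (fun x =>
        ((x.1.1 / Nat.gcd x.1.1 x.2.1, x.1.2 / Nat.gcd x.1.2 x.2.2),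
          (Nat.gcd x.1.1 x.2.1, Nat.gcd x.1.2 x.2.2)))
      · rintro ⟨⟨p, q⟩, ⟨r, s⟩⟩ hx
        simp only [Finset.coe_filter, Set.mem_ofPred_eq] at hx
        obtain ⟨hxP, hxz⟩ := hx
        obtain ⟨⟨hp, hq, hpq, -⟩, ⟨hr, hs, hrs, -⟩, hg⟩ := hP _ hxP
        simp only at hp hq hpq hr hs hrs
        have hk := key_num_den hp hq hr hs hpq hrs
        rw [hxz] at hk
        simp only [Finset.coe_product, Set.mem_prod, Finset.mem_coe, Nat.mem_divisors, hD,
          Finset.mem_biUnion, Nat.mem_divisorsAntidiagonal, Finset.mem_Icc]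
        have g1 := Nat.gcd_pos_of_pos_left r hp
        have g2 := Nat.gcd_pos_of_pos_left s hq
        refine ⟨⟨⟨⟨_, hk.1⟩, num_pos.ne'⟩, ⟨⟨_, hk.2⟩, den_pos.ne'⟩⟩, _, ⟨?_, ?_⟩, rfl, ?_⟩
        · exact Nat.mul_pos g1 g2
        · exact Nat.le_floor hg
        · exact (Nat.mul_pos g1 g2).ne'
      · rintro ⟨⟨p, q⟩, ⟨r, s⟩⟩ hx ⟨⟨p', q'⟩, ⟨r', s'⟩⟩ hx' heq
        simp only [Finset.coe_filter, Set.mem_ofPred_eq] at hx hx'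
        obtain ⟨hxP, hxz⟩ := hx
        obtain ⟨hxP', hxz'⟩ := hx'
        obtain ⟨⟨hp, hq, hpq, -⟩, ⟨hr, hs, hrs, -⟩, -⟩ := hP _ hxP
        obtain ⟨⟨hp', hq', hpq', -⟩, ⟨hr', hs', hrs', -⟩, -⟩ := hP _ hxP'
        simp only at hp hq hpq hr hs hrs hp' hq' hpq' hr' hs' hrs'
        have hk := key_num_den hp hq hr hs hpq hrs
        have hk' := key_num_den hp' hq' hr' hs' hpq' hrs'
        rw [hxz] at hk
        rw [hxz'] at hk'
        simp only [Prod.mk.injEq] at heq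
        obtain ⟨⟨e1, e2⟩, e3, e4⟩ := heq
        have i1 := Nat.div_mul_cancel (Nat.gcd_dvd_left p r)
        have i2 := Nat.div_mul_cancel (Nat.gcd_dvd_right p r)
        have i3 := Nat.div_mul_cancel (Nat.gcd_dvd_left q s)
        have i4 := Nat.div_mul_cancel (Nat.gcd_dvd_right q s)
        have i1' := Nat.div_mul_cancel (Nat.gcd_dvd_left p' r')
        have i2' := Nat.div_mul_cancel (Nat.gcd_dvd_right p' r')
        have i3' := Nat.div_mul_cancel (Nat.gcd_dvd_left q' s')
        have i4' := Nat.div_mul_cancel (Nat.gcd_dvd_right q' s')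
        have u1 : 0 < p' / p'.gcd r' :=
          Nat.div_pos (Nat.gcd_le_left _ hp') (Nat.gcd_pos_of_pos_left _ hp')
        have u2 : 0 < q' / q'.gcd s' :=
          Nat.div_pos (Nat.gcd_le_left _ hq') (Nat.gcd_pos_of_pos_left _ hq')
        have v1 : s / q.gcd s = s' / q'.gcd s' := by
          have := hk.1.symm.trans hk'.1
          rw [e1] at this
          exact Nat.eq_of_mul_eq_mul_left u1 this
        have v2 : r / p.gcd r = r' / p'.gcd r' := by
          have := hk.2.symm.trans hk'.2
          rw [e2] at this
          exact Nat.eq_of_mul_eq_mul_left u2 this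
        rw [e1, e3, i1'] at i1
        rw [v2, e3, i2'] at i2
        rw [e2, e4, i3'] at i3
        rw [v1, e4, i4'] at i4
        subst i1 i2 i3 i4
        rfl
    calc ((P.filter (fun x => key x = z)).card : ℝ)
        ≤ (((z.num.natAbs.divisors ×ˢ z.den.divisors) ×ˢ D).card : ℝ) := by exact_mod_cast hcard
      _ = (z.num.natAbs.divisors.card : ℝ) * z.den.divisors.card * D.card := by
        rw [Finset.card_product, Finset.card_product]; push_cast; ring
      _ ≤ F := by rw [hF]; gcongr
  calc (P.card : ℝ) ≤ (⌊F⌋₊ : ℝ) * (P.image key).card := by exact_mod_cast main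
    _ ≤ _ := by gcongr; exact Nat.floor_le hF0

/-- elements divisible by w -/
def dv (A : Finset (ℕ × ℕ)) (w : ℕ × ℕ) : Finset (ℕ × ℕ) := A.filter (fun a => w.1 ∣ a.1 ∧ w.2 ∣ a.2)

theorem sum_dv (N2 E c M : ℝ) (hE : 1 ≤ E) (hc : 0 ≤ c) (hM : 1 ≤ M) (hMN : M * M ≤ N2)
    (hτ : ∀ m : ℕ, 1 ≤ m → (m:ℝ) ≤ N2 → (m.divisors.card : ℝ) ≤ E * (m:ℝ) ^ c)
    (A W : Finset (ℕ × ℕ)) (hA : ∀ a ∈ A, Good M a) :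
    ∑ w ∈ W, ((dv A w).card : ℝ) ≤ E ^ 2 * M ^ c * A.card := by
  have h1 : ∑ w ∈ W, (dv A w).card = ∑ a ∈ A, (W.filter (fun w => w.1 ∣ a.1 ∧ w.2 ∣ a.2)).card := by
    simp only [dv]
    exact (Finset.sum_card_bipartiteAbove_eq_sum_card_bipartiteBelow (s := W) (t := A)
      (fun w a => w.1 ∣ a.1 ∧ w.2 ∣ a.2))
  have h2 : ∀ a ∈ A, ((W.filter (fun w => w.1 ∣ a.1 ∧ w.2 ∣ a.2)).card : ℝ) ≤ E ^ 2 * M ^ c := by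
    intro a ha
    obtain ⟨hp, hq, -, hpq⟩ := hA a ha
    have p1 : (1:ℝ) ≤ a.1 := by exact_mod_cast hp
    have q1 : (1:ℝ) ≤ a.2 := by exact_mod_cast hq
    have : (W.filter (fun w => w.1 ∣ a.1 ∧ w.2 ∣ a.2)).card ≤ (a.1.divisors ×ˢ a.2.divisors).card := by
      apply Finset.card_le_card
      intro w hw
      simp only [Finset.mem_filter] at hw
      simp [hw.2, hp.ne', hq.ne']
    calc ((W.filter (fun w => w.1 ∣ a.1 ∧ w.2 ∣ a.2)).card : ℝ)
        ≤ (a.1.divisors.card : ℝ) * a.2.divisors.card := by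
          rw [Finset.card_product] at this; exact_mod_cast this
      _ ≤ (E * (a.1 : ℝ) ^ c) * (E * (a.2 : ℝ) ^ c) := by
          gcongr
          · exact hτ _ hp (by nlinarith)
          · exact hτ _ hq (by nlinarith)
      _ = E ^ 2 * ((a.1:ℝ) * a.2) ^ c := by
          rw [Real.mul_rpow (by positivity) (by positivity)]; ring
      _ ≤ _ := by gcongr
  calc ∑ w ∈ W, ((dv A w).card : ℝ)
      = ∑ a ∈ A, ((W.filter (fun w => w.1 ∣ a.1 ∧ w.2 ∣ a.2)).card : ℝ) := by exact_mod_cast h1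
    _ ≤ ∑ a ∈ A, E ^ 2 * M ^ c := Finset.sum_le_sum h2
    _ = _ := by simp; ring

/-- the inductive claim -/
def Claim (M K : ℝ) : Prop := ∀ A B : Finset (ℕ × ℕ), (∀ a ∈ A, Good M a) → (∀ b ∈ B, Good M b) →
  (A.card : ℝ) * B.card ≤ K * ((A ×ˢ B).image key).card

theorem claim_dv (M K H : ℝ) (hH : 0 < H) (hC : Claim M K) (A B : Finset (ℕ × ℕ))
    (hA : ∀ a ∈ A, Good (M * H) a) (hB : ∀ a ∈ B, Good (M * H) a) (hK : 0 ≤ K)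
    (w : ℕ × ℕ) (hw1 : 0 < w.1) (hw2 : 0 < w.2) (hw : H ≤ (w.1 * w.2 : ℝ)) :
    ((dv A w).card : ℝ) * (dv B w).card ≤ K * ((A ×ˢ B).image key).card := by
  obtain ⟨d, e⟩ := w
  simp only at hw1 hw2 hw
  let f : ℕ × ℕ → ℕ × ℕ := fun a => (a.1 / d, a.2 / e)
  have inj : ∀ S : Finset (ℕ × ℕ), ((dv S (d, e)).image f).card = (dv S (d, e)).card := by
    intro S
    apply Finset.card_image_of_injOn
    rintro ⟨p, q⟩ h ⟨p', q'⟩ h' heq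
    simp only [dv, Finset.coe_filter, Set.mem_ofPred_eq] at h h'
    simp only [f, Prod.mk.injEq] at heq
    obtain ⟨-, h1, h2⟩ := h
    obtain ⟨-, h1', h2'⟩ := h'
    have e1 := Nat.div_mul_cancel h1
    have e2 := Nat.div_mul_cancel h2
    rw [heq.1, Nat.div_mul_cancel h1'] at e1
    rw [heq.2, Nat.div_mul_cancel h2'] at e2
    simp [e1, e2]
  have good : ∀ S : Finset (ℕ × ℕ), (∀ a ∈ S, Good (M * H) a) → ∀ a ∈ (dv S (d, e)).image f, Good M a := by
    intro S hS a ha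
    rw [Finset.mem_image] at ha
    obtain ⟨⟨p, q⟩, hx, rfl⟩ := ha
    simp only [dv, Finset.mem_filter] at hx
    obtain ⟨hx, ⟨p, rfl⟩, ⟨q, rfl⟩⟩ := hx
    obtain ⟨h1, h2, h3, h4⟩ := hS _ hx
    simp only [f, Nat.mul_div_cancel_left _ hw1, Nat.mul_div_cancel_left _ hw2]
    simp only at h1 h2 h3 h4
    refine ⟨Nat.pos_of_mul_pos_left h1, Nat.pos_of_mul_pos_left h2,
      Nat.Coprime.coprime_mul_left_right (Nat.Coprime.coprime_mul_left h3), ?_⟩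
    simp only
    push_cast at h4
    have : (p * q : ℝ) * H ≤ M * H := by
      calc (p * q : ℝ) * H ≤ (p * q : ℝ) * (d * e) := by gcongr
        _ = _ := by ring
        _ ≤ _ := h4
    exact le_of_mul_le_mul_right this hH
  have := hC _ _ (good A hA) (good B hB)
  rw [inj, inj] at this
  refine this.trans ?_
  refine mul_le_mul_of_nonneg_left (Nat.cast_le.2 (Finset.card_le_card ?_)) hK
  intro z hz
  simp only [Finset.mem_image, Finset.mem_product, Prod.exists] at hz ⊢
  obtain ⟨p', q', r', s', ⟨⟨p, q, h, h1⟩, ⟨r, s, h', h2⟩⟩, rfl⟩ := hz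
  simp only [f, Prod.mk.injEq] at h1 h2
  simp only [dv, Finset.mem_filter] at h h'
  obtain ⟨h, ⟨p, rfl⟩, ⟨q, rfl⟩⟩ := h
  obtain ⟨h', ⟨r, rfl⟩, ⟨s, rfl⟩⟩ := h'
  refine ⟨_, _, _, _, ⟨h, h'⟩, ?_⟩
  simp only [Nat.mul_div_cancel_left _ hw1, Nat.mul_div_cancel_left _ hw2] at h1 h2
  obtain ⟨rfl, rfl⟩ := h1
  obtain ⟨rfl, rfl⟩ := h2
  simp only [key]
  push_cast
  have d0 : (d:ℚ) ≠ 0 := by positivity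
  have e0 : (e:ℚ) ≠ 0 := by positivity
  rw [mul_div_mul_comm, mul_div_mul_comm (d:ℚ) r, mul_div_mul_left]
  positivity

theorem cs_aux {ι : Type*} (W : Finset ι) (a b : ι → ℝ) (ha : ∀ w, 0 ≤ a w) (hb : ∀ w, 0 ≤ b w)
    (R T x y : ℝ) (hR : 0 ≤ R) (hT : 0 ≤ T) (hx : 0 ≤ x) (hy : 0 ≤ y)
    (hw : ∀ w ∈ W, a w * b w ≤ R) (sA : ∑ w ∈ W, a w ≤ T * x) (sB : ∑ w ∈ W, b w ≤ T * y)
    (hS : x * y ≤ 2 * ∑ w ∈ W, a w * b w) : x * y ≤ 4 * T ^ 2 * R := by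
  set S := ∑ w ∈ W, a w * b w with hSdef
  have hcs : S ≤ √R * (√(T * x) * √(T * y)) := by
    calc S = ∑ w ∈ W, √(a w * b w) * (√(a w) * √(b w)) := by
          refine Finset.sum_congr rfl fun w _ => ?_
          rw [← Real.sqrt_mul (ha w), Real.mul_self_sqrt (mul_nonneg (ha w) (hb w))]
      _ ≤ ∑ w ∈ W, √R * (√(a w) * √(b w)) := by
          refine Finset.sum_le_sum fun w hw' => ?_
          exact mul_le_mul_of_nonneg_right (Real.sqrt_le_sqrt (hw w hw')) (by positivity)
      _ = √R * ∑ w ∈ W, (√(a w) * √(b w)) := by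
          rw [Finset.mul_sum]
      _ ≤ √R * (√(∑ w ∈ W, a w) * √(∑ w ∈ W, b w)) := by
          gcongr
          exact Real.sum_sqrt_mul_sqrt_le W ha hb
      _ ≤ _ := by gcongr
  have hY0 : 0 ≤ x * y := by positivity
  have hsq : S ^ 2 ≤ R * (T ^ 2 * (x * y)) := by
    have h0 : 0 ≤ S := by linarith
    calc S ^ 2 ≤ (√R * (√(T * x) * √(T * y))) ^ 2 := by gcongr
      _ = _ := by
        rw [mul_pow, mul_pow, Real.sq_sqrt (by positivity), Real.sq_sqrt (by positivity),
          Real.sq_sqrt (by positivity)]; ring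
  have hfin : (x * y) * (x * y) ≤ (4 * T ^ 2 * R) * (x * y) := by nlinarith
  rcases hY0.eq_or_lt with h | h
  · rw [← h]; positivity
  · exact le_of_mul_le_mul_right hfin h

theorem step (N2 E c M H K : ℝ) (hE : 1 ≤ E) (hc : 0 ≤ c) (hM : 1 ≤ M) (hH : 1 ≤ H)
    (hMN : (M * H) * (M * H) ≤ N2) (hK : 0 ≤ K)
    (hτ : ∀ m : ℕ, 1 ≤ m → (m:ℝ) ≤ N2 → (m.divisors.card : ℝ) ≤ E * (m:ℝ) ^ c)
    (hC : Claim M K) (K' : ℝ)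
    (h1 : 2 * (E ^ 2 * (M * H) ^ (2 * c) * (E * H ^ (1 + c))) ≤ K')
    (h2 : 4 * (E ^ 2 * (M * H) ^ c) ^ 2 * K ≤ K') : Claim (M * H) K' := by
  intro A B hA hB
  have hMH : 1 ≤ M * H := by nlinarith
  set X := ((A ×ˢ B).image key).card with hX
  let P := (A ×ˢ B).filter (fun x => (gh x : ℝ) ≤ H)
  let P' := (A ×ˢ B).filter (fun x => ¬ (gh x : ℝ) ≤ H)
  have hPP : (P.card : ℝ) + P'.card = A.card * B.card := by
    have := Finset.card_filter_add_card_filter_not (s := A ×ˢ B) (fun x => (gh x : ℝ) ≤ H)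
    rw [Finset.card_product] at this
    exact_mod_cast this
  by_cases hcase : (A.card * B.card : ℝ) ≤ 2 * P.card
  · have := fiber_bound N2 E c (M * H) H hE hc hMH hMN hH (by nlinarith) hτ P (by
      intro x hx
      simp only [P, Finset.mem_filter, Finset.mem_product] at hx
      exact ⟨hA _ hx.1.1, hB _ hx.1.2, hx.2⟩)
    have hle : ((P.image key).card : ℝ) ≤ X := by
      rw [hX]; exact_mod_cast Finset.card_le_card (Finset.image_subset_image (Finset.filter_subset _ _))
    calc (A.card * B.card : ℝ) ≤ 2 * ((E ^ 2 * (M * H) ^ (2 * c) * (E * H ^ (1 + c))) * X) := by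
          refine hcase.trans ?_
          gcongr
          refine this.trans ?_
          gcongr
      _ = (2 * (E ^ 2 * (M * H) ^ (2 * c) * (E * H ^ (1 + c)))) * X := by ring
      _ ≤ K' * X := by gcongr
  · push Not at hcase
    let g : (ℕ × ℕ) × (ℕ × ℕ) → ℕ × ℕ := fun x => (Nat.gcd x.1.1 x.2.1, Nat.gcd x.1.2 x.2.2)
    set W := P'.image g with hW
    have hS : (P'.card : ℝ) ≤ ∑ w ∈ W, ((dv A w).card : ℝ) * (dv B w).card := by
      have : P'.card ≤ ∑ w ∈ W, (dv A w ×ˢ dv B w).card := by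
        rw [Finset.card_eq_sum_card_image g P']
        refine Finset.sum_le_sum fun w _ => Finset.card_le_card ?_
        intro x hx
        simp only [P', Finset.mem_filter, Finset.mem_product] at hx
        obtain ⟨⟨⟨ha, hb⟩, -⟩, rfl⟩ := hx
        simp only [dv, Finset.mem_product, Finset.mem_filter, g]
        exact ⟨⟨ha, Nat.gcd_dvd_left _ _, Nat.gcd_dvd_left _ _⟩,
          ⟨hb, Nat.gcd_dvd_right _ _, Nat.gcd_dvd_right _ _⟩⟩
      simp only [Finset.card_product] at this
      exact_mod_cast this
    have hw : ∀ w ∈ W, ((dv A w).card : ℝ) * (dv B w).card ≤ K * X := by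
      intro w hw
      rw [hW, Finset.mem_image] at hw
      obtain ⟨x, hx, rfl⟩ := hw
      simp only [P', Finset.mem_filter, Finset.mem_product, not_le] at hx
      obtain ⟨⟨ha, hb⟩, hg⟩ := hx
      apply claim_dv M K H (by linarith) hC A B hA hB hK
      · exact Nat.gcd_pos_of_pos_left _ (hA _ ha).1
      · exact Nat.gcd_pos_of_pos_left _ (hA _ ha).2.1
      · simp only [gh] at hg; push_cast at hg; exact hg.le
    set T := E ^ 2 * (M * H) ^ c with hT
    have hT0 : 0 ≤ T := by positivity
    have sA := sum_dv N2 E c (M * H) hE hc hMH hMN hτ A W hA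
    have sB := sum_dv N2 E c (M * H) hE hc hMH hMN hτ B W hB
    rw [← hT] at sA sB
    have := cs_aux W (fun w => ((dv A w).card : ℝ)) (fun w => ((dv B w).card : ℝ))
      (fun _ => Nat.cast_nonneg _) (fun _ => Nat.cast_nonneg _) (K * X) T A.card B.card
      (by positivity) hT0 (by positivity) (by positivity) hw sA sB (by linarith)
    calc (A.card * B.card : ℝ) ≤ 4 * T ^ 2 * (K * X) := this
      _ = 4 * T ^ 2 * K * X := by ring
      _ ≤ K' * X := by gcongr

theorem claim_pow (N2 E c H : ℝ) (hE : 1 ≤ E) (hc : 0 ≤ c) (hH : 1 ≤ H)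
    (hτ : ∀ m : ℕ, 1 ≤ m → (m:ℝ) ≤ N2 → (m.divisors.card : ℝ) ≤ E * (m:ℝ) ^ c) (n : ℕ) 
    (hn : H ^ n * H ^ n ≤ N2) :
    Claim (H ^ n) ((4 * E ^ 4) ^ n * H ^ (c * (n * (n + 1))) * (2 * E ^ 3 * H ^ (1 + c))) := by
  have hH0 : 0 < H := by linarith
  have hb : 1 ≤ 2 * E ^ 3 * H ^ (1 + c) := by
    have h1 : 1 ≤ E ^ 3 := one_le_pow₀ hE
    have h2 : 1 ≤ H ^ (1 + c) := Real.one_le_rpow hH (by linarith)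
    nlinarith
  induction n with
  | zero =>
    intro A B hA hB
    have hsub : ∀ S : Finset (ℕ × ℕ), (∀ a ∈ S, Good (H ^ 0) a) → S ⊆ {(1, 1)} := by
      intro S hS a ha
      obtain ⟨h1, h2, -, h3⟩ := hS a ha
      rw [pow_zero] at h3
      have h3 : a.1 * a.2 ≤ 1 := by exact_mod_cast h3
      have e1 : a.1 = 1 := by nlinarith
      have e2 : a.2 = 1 := by nlinarith
      simp [Prod.ext_iff, e1, e2]
    have hAB : (A ×ˢ B).card ≤ ((A ×ˢ B).image key).card := by
      rw [Finset.card_image_of_injOn]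
      rintro ⟨a, b⟩ h ⟨a', b'⟩ h' -
      simp only [Finset.coe_product, Set.mem_prod, Finset.mem_coe] at h h'
      have := hsub A hA h.1
      have := hsub A hA h'.1
      have := hsub B hB h.2
      have := hsub B hB h'.2
      simp_all
    rw [Finset.card_product] at hAB
    have hAB' : (A.card : ℝ) * B.card ≤ ((A ×ˢ B).image key).card := by exact_mod_cast hAB
    refine hAB'.trans ?_
    simp only [pow_zero, Nat.cast_zero, zero_mul, mul_zero, Real.rpow_zero, one_mul]
    exact le_mul_of_one_le_left (by positivity) hb
  | succ n ih =>
    have hMn : 1 ≤ H ^ n := one_le_pow₀ hH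
    have hle : H ^ n ≤ H ^ (n + 1) := pow_le_pow_right₀ hH (by omega)
    have ih := ih (le_trans (by gcongr) hn)
    rw [pow_succ]
    have hp : ∀ y : ℝ, (H ^ n * H) ^ y = H ^ ((n + 1) * y) := by
      intro y
      rw [← pow_succ, ← Real.rpow_natCast, ← Real.rpow_mul hH0.le]
      push_cast; rfl
    refine step N2 E c (H ^ n) H _ hE hc hMn hH (by rw [← pow_succ]; exact hn) (by positivity) hτ ih _ ?_ ?_
    · rw [hp]
      have e1 : 2 * (E ^ 2 * H ^ (((n:ℝ) + 1) * (2 * c)) * (E * H ^ (1 + c))) =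
        (1 * H ^ (((n:ℝ) + 1) * (2 * c))) * (2 * E ^ 3 * H ^ (1 + c)) := by ring
      rw [e1]
      gcongr ?_ * ?_ * _
      · apply one_le_pow₀
        have := one_le_pow₀ (n := 4) hE
        linarith
      · apply Real.rpow_le_rpow_of_exponent_le hH
        push_cast
        have : 0 ≤ c * ((n + 1) * n) := by positivity
        nlinarith
    · rw [hp, mul_pow, ← Real.rpow_natCast (H ^ _) 2, ← Real.rpow_mul hH0.le]
      have e2 : c * (((n + 1 : ℕ):ℝ) * (((n + 1 : ℕ) : ℝ) + 1)) = ((n:ℝ) + 1) * c * ((2:ℕ):ℝ) + c * (n * (n + 1)) := by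
        push_cast; ring
      rw [e2, Real.rpow_add hH0 (((n:ℝ) + 1) * c * ((2:ℕ):ℝ))]
      apply le_of_eq
      generalize H ^ (((n:ℝ) + 1) * c * ((2:ℕ):ℝ)) = u
      generalize H ^ (c * ((n:ℝ) * (n + 1))) = v
      ring

theorem to_claim (Q Q' M K : ℝ) (hM : Q * Q' ≤ M) (hQ : 1 ≤ Q) (hK : 0 ≤ K) (hC : Claim M K) (A B : Finset ℚ)
    (hA : ↑A ⊆ farey Q Q') (hB : ↑B ⊆ farey Q Q') :
    (A.card : ℝ) * B.card ≤ K * ((A / B).card : ℝ) := by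
  let f : ℚ → ℕ × ℕ := fun z => (z.num.natAbs, z.den)
  have pos : ∀ z ∈ farey Q Q', 0 < z := by
    rintro z ⟨q, q', h1, -, h2, -, rfl⟩
    positivity
  have inv : ∀ z ∈ farey Q Q', ((f z).1 : ℚ) / (f z).2 = z := by
    intro z hz
    have h0 := pos z hz
    simp only [f]
    have : ((z.num.natAbs : ℕ) : ℚ) = (z.num : ℚ) := by
      rw [Nat.cast_natAbs, abs_of_pos (Rat.num_pos.2 h0)]
    rw [this, Rat.num_div_den]
  have good : ∀ z ∈ farey Q Q', Good M (f z) := by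
    intro z hz
    have h0 := pos z hz
    refine ⟨Int.natAbs_pos.2 (Rat.num_pos.2 h0).ne', z.den_pos, z.reduced, ?_⟩
    obtain ⟨q, q', h1, h1', h2, h2', rfl⟩ := hz
    have hn : ((q:ℚ) / q').num.natAbs ≤ q := by
      have := Rat.num_dvd (q:ℤ) (b := (q':ℤ)) (by exact_mod_cast (by omega : q' ≠ 0))
      rw [Rat.divInt_eq_div] at this
      push_cast at this
      have := Int.natAbs_dvd_natAbs.2 this
      exact Nat.le_of_dvd h1 (by simpa using this)
    have hd : ((q:ℚ) / q').den ≤ q' := by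
      have := Rat.den_dvd (q:ℤ) (q':ℤ)
      rw [Rat.divInt_eq_div] at this
      push_cast at this
      exact Nat.le_of_dvd h2 (by exact_mod_cast this)
    simp only [f]
    refine le_trans ?_ hM
    gcongr
    · exact le_trans (by exact_mod_cast hn) h1'
    · exact le_trans (by exact_mod_cast hd) h2'
  have inj : ∀ S : Finset ℚ, ↑S ⊆ farey Q Q' → (S.image f).card = S.card := by
    intro S hS
    apply Finset.card_image_of_injOn
    intro x hx y hy hxy
    rw [← inv x (hS hx), ← inv y (hS hy), hxy]
  have gd : ∀ S : Finset ℚ, ↑S ⊆ farey Q Q' → ∀ a ∈ S.image f, Good M a := by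
    intro S hS a ha
    rw [Finset.mem_image] at ha
    obtain ⟨z, hz, rfl⟩ := ha
    exact good z (hS hz)
  have := hC _ _ (gd A hA) (gd B hB)
  rw [inj A hA, inj B hB] at this
  refine this.trans ?_
  gcongr
  intro z hz
  simp only [Finset.mem_image, Finset.mem_product] at hz
  obtain ⟨⟨a, b⟩, ⟨⟨x, hx, rfl⟩, ⟨y, hy, rfl⟩⟩, rfl⟩ := hz
  simp only [key]
  rw [inv x (hA hx), inv y (hB hy)]
  exact Finset.div_mem_div hx hy

theorem final_bound (Q Q' L : ℝ) (hQ : 1 ≤ Q) (hQ' : 1 ≤ Q') (hL : L = Real.log (Q * Q'))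
    (n t : ℕ) (hn : 1 ≤ n) (ht : 2 ≤ t) (A B : Finset ℚ)
    (hA : ↑A ⊆ farey Q Q') (hB : ↑B ⊆ farey Q Q') :
    (A.card : ℝ) * B.card ≤ Real.exp (n * Real.log 4 + (4 * n + 3) * (t * Real.log (1 + 3 * L)) +
      Real.log 2 + Real.log 2 / Real.log t * L * (n + 1) + (1 + Real.log 2 / Real.log t) * L / n) *
      ((A / B).card : ℝ) := by
  have hN1 : 1 ≤ Q * Q' := by nlinarith
  have hL0 : 0 ≤ L := by rw [hL]; exact Real.log_nonneg hN1
  have hN : Q * Q' = Real.exp L := by rw [hL, Real.exp_log (by linarith)]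
  have hl2 : 0 < Real.log 2 := Real.log_pos (by norm_num)
  have hlt : 0 < Real.log t := Real.log_pos (by exact_mod_cast ht)
  have hn0 : (0:ℝ) < n := by exact_mod_cast hn
  set c := Real.log 2 / Real.log t with hc
  have hc0 : 0 ≤ c := by positivity
  set E := (1 + 3 * L) ^ t with hE
  have hE1 : 1 ≤ E := one_le_pow₀ (by linarith)
  have hEexp : E = Real.exp (t * Real.log (1 + 3 * L)) := by
    rw [← Real.log_pow, Real.exp_log (by positivity)]
  set H := Real.exp (L / n) with hH
  have hH1 : 1 ≤ H := Real.one_le_exp (by positivity)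
  have hHn : H ^ n = Real.exp L := by
    rw [hH, ← Real.exp_nat_mul]; congr 1; field_simp
  have hτ : ∀ m : ℕ, 1 ≤ m → (m:ℝ) ≤ Real.exp (2 * L) → (m.divisors.card : ℝ) ≤ E * (m:ℝ) ^ c := by
    intro m hm hmL
    refine divisor_bound t ht (1 + 3 * L) m hm ?_
    have h1 : Real.log m ≤ 2 * L := by
      rw [Real.log_le_iff_le_exp (by exact_mod_cast hm)]; exact hmL
    have h2 : Real.log m / Real.log 2 ≤ 3 * L := by
      rw [div_le_iff₀ hl2]
      have := Real.log_two_gt_d9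
      nlinarith
    linarith
  have hC := claim_pow (Real.exp (2 * L)) E c H hE1 hc0 hH1 hτ n (by
    rw [hHn, ← Real.exp_add, two_mul])
  rw [hHn] at hC
  have := to_claim Q Q' _ _ hN.le hQ (by positivity) hC A B hA hB
  refine this.trans (le_of_eq ?_)
  congr 1
  have e4 : (4:ℝ) = Real.exp (Real.log 4) := (Real.exp_log (by norm_num)).symm
  have e2 : (2:ℝ) = Real.exp (Real.log 2) := (Real.exp_log (by norm_num)).symm
  have hpow : ∀ y, H ^ y = Real.exp (L / n * y) := fun y => by rw [hH, Real.exp_mul]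
  have e5 : (4 * E ^ 4) ^ n * H ^ (c * (n * (n + 1))) * (2 * E ^ 3 * H ^ (1 + c)) =
      (Real.exp (Real.log 4) * E ^ 4) ^ n * H ^ (c * (n * (n + 1))) *
        (Real.exp (Real.log 2) * E ^ 3 * H ^ (1 + c)) := by rw [← e4, ← e2]
  rw [e5, hpow, hpow, hEexp]
  simp only [← Real.exp_nat_mul, ← Real.exp_add]
  congr 1
  push_cast
  field_simp
  ring

theorem asymp (ε : ℝ) (hε : 0 < ε) : ∀ᶠ s : ℝ in Filter.atTop, 0 < s ∧ ∃ n t : ℕ, 1 ≤ n ∧ 2 ≤ t ∧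
    n * Real.log 4 + (4 * n + 3) * (t * Real.log (1 + 3 * Real.exp (s ^ 2))) +
      Real.log 2 + Real.log 2 / Real.log t * Real.exp (s ^ 2) * (n + 1) +
        (1 + Real.log 2 / Real.log t) * Real.exp (s ^ 2) / n ≤
      (2 * √(Real.log 2) + ε) * Real.exp (s ^ 2) / s := by
  have hl2 : 0 < Real.log 2 := Real.log_pos (by norm_num)
  have hl4 : Real.log 4 = 2 * Real.log 2 := by
    rw [show (4:ℝ) = 2 ^ 2 by norm_num, Real.log_pow]; norm_num
  have hl2' : Real.log 2 < 1 := by have := Real.log_two_lt_d9; linarith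
  set a := √(Real.log 2) with ha
  have ha0 : 0 < a := Real.sqrt_pos.2 hl2
  have haa : a * a = Real.log 2 := Real.mul_self_sqrt hl2.le
  -- limits
  have hx : Filter.Tendsto (fun s : ℝ => s⁻¹) Filter.atTop (nhds 0) := tendsto_inv_atTop_zero
  have hy : Filter.Tendsto (fun s : ℝ => Real.log s / s * s⁻¹) Filter.atTop (nhds 0) := by
    have := (Real.isLittleO_log_id_atTop.tendsto_div_nhds_zero).mul hx
    simpa using this
  have hxy := hx.prodMk_nhds hy
  let g : ℝ × ℝ → ℝ := fun z => ((z.1 ^ 4 / a + z.1 ^ 5) * Real.log 4 + z.1 ^ 5 * Real.log 2) +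
    2 * (4 / a + 7 * z.1) * (1 + 2 * z.1 ^ 2) * z.1 ^ 2 +
      Real.log 2 * (1 / a + 3 * z.1) / (1 - 6 * z.2) + a
  have hg : ContinuousAt g (0, 0) := by
    have : (1 - 6 * ((0, 0) : ℝ × ℝ).2) ≠ 0 := by simp
    fun_prop (disch := assumption)
  have hg0 : g (0, 0) < 2 * a + ε := by
    have : Real.log 2 / a = a := by rw [← haa]; field_simp
    simp only [g]
    norm_num
    rw [← div_eq_mul_inv, this]; linarith
  have hev := (hg.tendsto.comp hxy).eventually (gt_mem_nhds hg0)
  have hys : ∀ᶠ s : ℝ in Filter.atTop, 6 * (Real.log s / s * s⁻¹) < 1 := by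
    have := hy.const_mul 6
    rw [mul_zero] at this
    exact this.eventually (gt_mem_nhds (by norm_num))
  have hexp : ∀ᶠ s : ℝ in Filter.atTop, 2 ≤ Real.exp s / s ^ 6 :=
    (Real.tendsto_exp_div_pow_atTop 6).eventually_ge_atTop 2
  filter_upwards [hev, hys, hexp, Filter.eventually_ge_atTop (1:ℝ)] with s h1 h2 h3 h4
  have hs0 : 0 < s := by linarith
  refine ⟨hs0, ?_⟩
  set L := Real.exp (s ^ 2) with hL
  have hL0 : 0 < L := Real.exp_pos _
  have hLs : 2 ≤ L / s ^ 6 := by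
    refine h3.trans ?_
    rw [hL]
    gcongr
    nlinarith
  have hLs' : s ^ 6 ≤ L := by
    rw [le_div_iff₀ (by positivity)] at hLs
    have : 0 < s ^ 6 := by positivity
    linarith
  refine ⟨⌈s / a⌉₊, ⌈L / s ^ 6⌉₊, Nat.ceil_pos.2 (by positivity), ?_, ?_⟩
  · exact_mod_cast hLs.trans (Nat.le_ceil _)
  have hn1 : s / a ≤ ⌈s / a⌉₊ := Nat.le_ceil _
  have hn2 : (⌈s / a⌉₊ : ℝ) ≤ s / a + 1 := (Nat.ceil_lt_add_one (by positivity)).le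
  have hn3 : (1:ℝ) ≤ ⌈s / a⌉₊ := by exact_mod_cast Nat.ceil_pos.2 (show 0 < s / a by positivity)
  have ht1 : L / s ^ 6 ≤ ⌈L / s ^ 6⌉₊ := Nat.le_ceil _
  have ht2 : (⌈L / s ^ 6⌉₊ : ℝ) ≤ 2 * (L / s ^ 6) := by
    have := (Nat.ceil_lt_add_one (show 0 ≤ L / s ^ 6 by positivity)).le
    linarith
  set n : ℝ := ((⌈s / a⌉₊ : ℕ) : ℝ) with hn
  set t : ℝ := ((⌈L / s ^ 6⌉₊ : ℕ) : ℝ) with ht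
  have hlogt : s ^ 2 - 6 * Real.log s ≤ Real.log t := by
    have : Real.log (L / s ^ 6) ≤ Real.log t := Real.log_le_log (by positivity) ht1
    rw [Real.log_div hL0.ne' (by positivity), hL, Real.log_exp, Real.log_pow] at this
    exact_mod_cast this
  have hpos : 0 < s ^ 2 - 6 * Real.log s := by
    have : 6 * (Real.log s / s * s⁻¹) = 6 * Real.log s / s ^ 2 := by field_simp
    rw [this, div_lt_one (by positivity)] at h2
    linarith
  have hlogL : Real.log (1 + 3 * L) ≤ s ^ 2 + 2 := by
    have hL1 : 1 ≤ L := Real.one_le_exp (by positivity)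
    calc Real.log (1 + 3 * L) ≤ Real.log (4 * L) := Real.log_le_log (by positivity) (by linarith)
      _ = Real.log 4 + s ^ 2 := by rw [Real.log_mul (by norm_num) hL0.ne', hL, Real.log_exp]
      _ ≤ _ := by linarith
  have hlogL0 : 0 ≤ Real.log (1 + 3 * L) := Real.log_nonneg (by linarith)
  have hc : Real.log 2 / Real.log t ≤ Real.log 2 / (s ^ 2 - 6 * Real.log s) := by gcongr
  set c := Real.log 2 / Real.log t with hcdef
  set c' := Real.log 2 / (s ^ 2 - 6 * Real.log s) with hc'
  have hc0 : 0 ≤ c := div_nonneg hl2.le (hpos.le.trans hlogt)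
  have hinv : 1 / n ≤ a / s := by
    rw [div_le_div_iff₀ (by linarith) hs0]
    rw [div_le_iff₀ ha0] at hn1
    linarith
  have b1 : n * Real.log 4 + Real.log 2 ≤ ((s / a + 1) * Real.log 4 + Real.log 2) * (L / s ^ 6) := by
    have h5 : 1 ≤ L / s ^ 6 := by linarith
    have h6 : n * Real.log 4 + Real.log 2 ≤ (s / a + 1) * Real.log 4 + Real.log 2 := by
      rw [hl4]; gcongr
    refine h6.trans (le_mul_of_one_le_right ?_ h5)
    rw [hl4]; positivity
  have b2 : (4 * n + 3) * (t * Real.log (1 + 3 * L)) ≤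
      (4 * (s / a + 1) + 3) * (2 * (L / s ^ 6) * (s ^ 2 + 2)) := by
    gcongr
  have b3 : c * L * (n + 1) + (1 + c) * L / n ≤ c' * L * (s / a + 3) + a / s * L := by
    have h7 : c * L / n ≤ c * L := div_le_self (by positivity) hn3
    have h8 : (1 + c) * L / n = 1 / n * L + c * L / n := by ring
    have h9 : c * L * (n + 2) ≤ c' * L * (s / a + 3) := by
      have : n + 2 ≤ s / a + 3 := by linarith
      gcongr
    have h10 : 1 / n * L ≤ a / s * L := by gcongr
    rw [h8]
    nlinarith
  have hG : g (s⁻¹, Real.log s / s * s⁻¹) * (L / s) =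
      ((s / a + 1) * Real.log 4 + Real.log 2) * (L / s ^ 6) +
      (4 * (s / a + 1) + 3) * (2 * (L / s ^ 6) * (s ^ 2 + 2)) +
      (c' * L * (s / a + 3) + a / s * L) := by
    have hden : 1 - 6 * (Real.log s / s * s⁻¹) = (s ^ 2 - 6 * Real.log s) / s ^ 2 := by
      field_simp
    simp only [g]
    rw [hden, hc']
    generalize hD : s ^ 2 - 6 * Real.log s = D at hpos
    field_simp
    ring
  have hGle : g (s⁻¹, Real.log s / s * s⁻¹) * (L / s) ≤ (2 * a + ε) * (L / s) := by
    have : g (s⁻¹, Real.log s / s * s⁻¹) ≤ 2 * a + ε := le_of_lt h1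
    gcongr
  rw [mul_div_assoc (2 * a + ε)]
  linarith

/-- Main theorem: for every `ε > 0` there is `C` such that whenever `QQ' ≥ C` and
`A, B ⊆ F_{Q,Q'}`,
`|A/B| ≥ |A||B| exp(−(2√(log 2) + ε) log(QQ')/√(log log(QQ')))`. -/
theorem main_quotient (ε : ℝ) (hε : 0 < ε) :
    ∃ C : ℝ, ∀ Q Q' : ℝ, 1 ≤ Q → 1 ≤ Q' → C ≤ Q * Q' →
      ∀ A B : Finset ℚ, ↑A ⊆ farey Q Q' → ↑B ⊆ farey Q Q' →
        (A.card : ℝ) * B.card *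
            Real.exp (-(2 * Real.sqrt (Real.log 2) + ε) * Real.log (Q * Q') /
              Real.sqrt (Real.log (Real.log (Q * Q'))))
          ≤ ((A / B).card : ℝ) := by
  have hlim : Filter.Tendsto (fun N : ℝ => √(Real.log (Real.log N))) Filter.atTop Filter.atTop :=
    Real.tendsto_sqrt_atTop.comp (Real.tendsto_log_atTop.comp Real.tendsto_log_atTop)
  have hev := hlim.eventually (asymp ε hε)
  have hev2 := hev.and (Real.tendsto_log_atTop.eventually_gt_atTop 1)
  obtain ⟨C, hC⟩ := Filter.eventually_atTop.1 hev2
  refine ⟨C, fun Q Q' hQ hQ' hCQ A B hA hB => ?_⟩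
  obtain ⟨⟨hs0, n, t, hn, ht, hle⟩, hL1⟩ := hC _ hCQ
  have hexp : Real.exp (√(Real.log (Real.log (Q * Q'))) ^ 2) = Real.log (Q * Q') := by
    rw [Real.sq_sqrt (Real.log_nonneg hL1.le), Real.exp_log (by linarith)]
  rw [hexp] at hle
  have hb := final_bound Q Q' _ hQ hQ' rfl n t hn ht A B hA hB
  have hb' := hb.trans (mul_le_mul_of_nonneg_right (Real.exp_le_exp.2 hle) (Nat.cast_nonneg _))
  rw [neg_mul, neg_div, Real.exp_neg, ← div_eq_mul_inv, div_le_iff₀ (Real.exp_pos _), mul_comm _ (Real.exp _)]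
  exact hb'
end

section
/- If A, B ⊆ F_Q = {q/q' : 1 ≤ q, q' ≤ Q}, then |AB| ≥ |A||B| · exp(−(4√(log 2) + o(1)) log Q / √(log log Q)), where AB = {ab : a ∈ A, b ∈ B} and o(1) → 0 as Q → ∞. -/
open scoped Pointwise

/-- The set `F_Q = {q/q' : 1 ≤ q, q' ≤ Q, q, q' positive integers}`. -/
def fareyQ (Q : ℝ) : Set ℚ :=
  {z : ℚ | ∃ q q' : ℕ, 1 ≤ q ∧ (q : ℝ) ≤ Q ∧ 1 ≤ q' ∧ (q' : ℝ) ≤ Q ∧ z = (q : ℚ) / (q' : ℚ)}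

/-- The weight attached to an exponent. -/
noncomputable def wt (j : ℤ) : ℝ := 1 / ((|j| : ℤ) + 1 : ℝ) ^ 2

lemma wt_pos (j : ℤ) : 0 < wt j := by
  unfold wt
  have : (0:ℝ) ≤ (|j| : ℤ) := by exact_mod_cast abs_nonneg j
  positivity

lemma wt_zero : wt 0 = 1 := by simp [wt]

lemma wt_le (j : ℤ) (hj : j ≠ 0) : wt j ≤ 1 / 4 := by
  unfold wt
  have : (1:ℝ) ≤ (|j| : ℤ) := by exact_mod_cast Int.one_le_abs hj
  apply one_div_le_one_div_of_le (by norm_num)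
  nlinarith

lemma wt_sum_Icc (n : ℕ) : ∑ j ∈ Finset.Icc (-(n:ℤ)) n, wt j ≤ 3 - 2 / ((n:ℝ) + 1) := by
  induction n with
  | zero => simp [wt_zero]; norm_num
  | succ n ih =>
    have h : Finset.Icc (-((n+1:ℕ):ℤ)) ((n+1:ℕ):ℤ)
        = insert (-((n+1:ℕ):ℤ)) (insert ((n+1:ℕ):ℤ) (Finset.Icc (-(n:ℤ)) n)) := by
      ext x; simp only [Finset.mem_Icc, Finset.mem_insert]; push_cast; omega
    rw [h, Finset.sum_insert, Finset.sum_insert]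
    · have e1 : wt (-((n+1:ℕ):ℤ)) = 1 / ((n:ℝ) + 2)^2 := by
        unfold wt; rw [abs_neg, Nat.abs_cast]; push_cast; ring
      have e2 : wt (((n+1:ℕ):ℤ)) = 1 / ((n:ℝ) + 2)^2 := by
        unfold wt; rw [Nat.abs_cast]; push_cast; ring
      rw [e1, e2]
      have h1 : 1 / ((n:ℝ)+2)^2 ≤ 1/((n:ℝ)+1) - 1/((n:ℝ)+2) := by
        have hn : (0:ℝ) ≤ n := n.cast_nonneg
        rw [div_sub_div _ _ (by positivity) (by positivity), div_le_div_iff₀ (by positivity) (by positivity)]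
        nlinarith
      push_cast
      have e3 : (2:ℝ) / (n + 1) = 2 * (1 / (n+1)) := by ring
      have e4 : (2:ℝ) / (n + 1 + 1) = 2 * (1 / (n+2)) := by ring
      rw [e3] at ih
      rw [e4]
      linarith
    · simp
    · simp only [Finset.mem_insert, Finset.mem_Icc]; push_cast; omega

lemma wt_sum (F : Finset ℤ) : ∑ j ∈ F, wt j ≤ 3 := by
  obtain ⟨n, hn⟩ : ∃ n : ℕ, F ⊆ Finset.Icc (-(n:ℤ)) n := by
    refine ⟨∑ j ∈ F, j.natAbs, fun j hj => ?_⟩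
    have := Finset.single_le_sum (f := fun j : ℤ => j.natAbs) (fun _ _ => Nat.zero_le _) hj
    simp only [Finset.mem_Icc]
    omega
  calc ∑ j ∈ F, wt j ≤ ∑ j ∈ Finset.Icc (-(n:ℤ)) n, wt j :=
        Finset.sum_le_sum_of_subset_of_nonneg hn fun _ _ _ => (wt_pos _).le
    _ ≤ 3 - 2 / ((n:ℝ) + 1) := wt_sum_Icc n
    _ ≤ 3 := by
        have : (0:ℝ) ≤ 2 / ((n:ℝ) + 1) := by positivity
        linarith

lemma wt_side (I : Finset ℤ) (α : ℤ → ℝ) (M : ℝ) (hα : ∀ i, 0 ≤ α i) (hM0 : 0 ≤ M)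
    (hM : ∀ i ∈ I, α i ≤ M) :
    ∑ i ∈ I, wt i * α i ≤ 3 * M ∧ ∑ i ∈ I, wt i * α i ≤ (3 * M + ∑ i ∈ I, α i) / 4 := by
  constructor
  · calc ∑ i ∈ I, wt i * α i ≤ ∑ i ∈ I, wt i * M :=
          Finset.sum_le_sum fun i hi => mul_le_mul_of_nonneg_left (hM i hi) (wt_pos i).le
      _ = (∑ i ∈ I, wt i) * M := by rw [Finset.sum_mul]
      _ ≤ 3 * M := mul_le_mul_of_nonneg_right (wt_sum I) hM0
  · have h : ∀ i ∈ I, wt i * α i ≤ (if i = 0 then 3 / 4 * M else 0) + α i / 4 := by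
      intro i hi
      split_ifs with h0
      · subst h0; rw [wt_zero]; linarith [hM 0 hi]
      · have := mul_le_mul_of_nonneg_right (wt_le i h0) (hα i)
        linarith
    refine (Finset.sum_le_sum h).trans ?_
    rw [Finset.sum_add_distrib, ← Finset.sum_div, Finset.sum_ite_eq']
    split_ifs <;> linarith

lemma aux_real (M N X Y P R G : ℝ) (hM : 0 < M) (hN : 0 < N) (hX : M ≤ X)
    (hP0 : 0 ≤ P) (hR0 : 0 ≤ R)
    (hP : P ≤ 3 * M) (hP' : P ≤ (3 * M + X) / 4) (hR : R ≤ 3 * N) (hR' : R ≤ (3 * N + Y) / 4)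
    (hG' : N * X ≤ G) (hw : M * Y ≤ N * X) : P * R ≤ G := by
  refine le_trans ?_ hG'
  by_cases h9 : 9 * M ≤ X
  · have : P * R ≤ (3 * M) * (3 * N) := mul_le_mul hP hR hR0 (by linarith)
    nlinarith
  · push Not at h9
    have h1 : M * R ≤ N * ((3 * M + X) / 4) := by nlinarith
    have h2 : P * (M * R) ≤ ((3 * M + X) / 4) * (N * ((3 * M + X) / 4)) :=
      mul_le_mul hP' h1 (by positivity) (by linarith)
    have h3 : (3 * M + X) ^ 2 ≤ 16 * X * M := by nlinarith [mul_nonneg (sub_nonneg.2 hX) (sub_nonneg.2 h9.le)]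
    have h4 : ((3 * M + X) / 4) * (N * ((3 * M + X) / 4)) ≤ M * (N * X) := by nlinarith
    have h5 : M * (P * R) ≤ M * (N * X) := by linarith
    exact le_of_mul_le_mul_left h5 hM

lemma one_dim (I J : Finset ℤ) (α β γ : ℤ → ℝ) (hα : ∀ i, 0 ≤ α i) (hβ : ∀ i, 0 ≤ β i)
    (hγ0 : ∀ s, 0 ≤ γ s) (hγ : ∀ i ∈ I, ∀ j ∈ J, α i * β j ≤ γ (i + j)) :
    (∑ i ∈ I, wt i * α i) * (∑ j ∈ J, wt j * β j) ≤ ∑ s ∈ I + J, γ s := by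
  have hG0 : 0 ≤ ∑ s ∈ I + J, γ s := Finset.sum_nonneg fun s _ => hγ0 s
  rcases I.eq_empty_or_nonempty with rfl | hI
  · simp
  rcases J.eq_empty_or_nonempty with rfl | hJ
  · simp
  obtain ⟨i0, hi0, hi0m⟩ := I.exists_max_image α hI
  obtain ⟨j0, hj0, hj0m⟩ := J.exists_max_image β hJ
  have hP0 : 0 ≤ ∑ i ∈ I, wt i * α i :=
    Finset.sum_nonneg fun i _ => mul_nonneg (wt_pos i).le (hα i)
  have hR0 : 0 ≤ ∑ i ∈ J, wt i * β i :=
    Finset.sum_nonneg fun i _ => mul_nonneg (wt_pos i).le (hβ i)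
  obtain ⟨hP, hP'⟩ := wt_side I α (α i0) hα (hα _) hi0m
  obtain ⟨hR, hR'⟩ := wt_side J β (β j0) hβ (hβ _) hj0m
  have hX : α i0 ≤ ∑ i ∈ I, α i := Finset.single_le_sum (fun i _ => hα i) hi0
  have hY : β j0 ≤ ∑ i ∈ J, β i := Finset.single_le_sum (fun i _ => hβ i) hj0
  have hG1 : α i0 * ∑ j ∈ J, β j ≤ ∑ s ∈ I + J, γ s := by
    calc α i0 * ∑ j ∈ J, β j ≤ ∑ j ∈ J, γ (i0 + j) := by
          rw [Finset.mul_sum]; exact Finset.sum_le_sum fun j hj => hγ i0 hi0 j hj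
      _ = ∑ s ∈ J.image (fun j => i0 + j), γ s := by
          rw [Finset.sum_image]; intro a _ b _ h; simpa using h
      _ ≤ _ := by
          apply Finset.sum_le_sum_of_subset_of_nonneg
          · intro s hs
            obtain ⟨j, hj, rfl⟩ := Finset.mem_image.1 hs
            exact Finset.add_mem_add hi0 hj
          · intro s _ _; exact hγ0 s
  have hG2 : β j0 * ∑ i ∈ I, α i ≤ ∑ s ∈ I + J, γ s := by
    calc β j0 * ∑ i ∈ I, α i ≤ ∑ i ∈ I, γ (i + j0) := by
          rw [Finset.mul_sum]
          exact Finset.sum_le_sum fun i hi => by rw [mul_comm]; exact hγ i hi j0 hj0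
      _ = ∑ s ∈ I.image (fun j => j + j0), γ s := by
          rw [Finset.sum_image]; intro a _ b _ h; simpa using h
      _ ≤ _ := by
          apply Finset.sum_le_sum_of_subset_of_nonneg
          · intro s hs
            obtain ⟨j, hj, rfl⟩ := Finset.mem_image.1 hs
            exact Finset.add_mem_add hj hj0
          · intro s _ _; exact hγ0 s
  rcases (hα i0).eq_or_lt with h0 | hM
  · have : ∑ i ∈ I, wt i * α i = 0 := le_antisymm (by rw [← h0] at hP; linarith) hP0
    rw [this, zero_mul]; exact hG0
  rcases (hβ j0).eq_or_lt with h0 | hN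
  · have : ∑ i ∈ J, wt i * β i = 0 := le_antisymm (by rw [← h0] at hR; linarith) hR0
    rw [this, mul_zero]; exact hG0
  rcases le_total (α i0 * ∑ j ∈ J, β j) (β j0 * ∑ i ∈ I, α i) with h | h
  · exact aux_real _ _ _ _ _ _ _ hM hN hX hP0 hR0 hP hP' hR hR' hG2 h
  · rw [mul_comm]
    exact aux_real _ _ _ _ _ _ _ hN hM hY hR0 hP0 hR hR' hP hP' hG1 h

lemma rat_eq_of_val (a b : ℚ) (ha : 0 < a) (hb : 0 < b)
    (h : ∀ p : ℕ, p.Prime → padicValRat p a = padicValRat p b) : a = b := by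
  have key : a.num.natAbs * b.den = b.num.natAbs * a.den := by
    have ha' : a.num.natAbs ≠ 0 := by simpa using ha.ne'
    have hb' : b.num.natAbs ≠ 0 := by simpa using hb.ne'
    apply Nat.eq_of_factorization_eq (mul_ne_zero ha' b.den_nz) (mul_ne_zero hb' a.den_nz)
    intro p
    by_cases hp : p.Prime
    · have := h p hp
      rw [padicValRat_def, padicValRat_def] at this
      rw [Nat.factorization_mul ha' b.den_nz, Nat.factorization_mul hb' a.den_nz]
      simp only [Finsupp.add_apply, Nat.factorization_def _ hp]
      simp only [padicValInt] at this
      omega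
    · rw [Nat.factorization_eq_zero_of_not_prime _ hp, Nat.factorization_eq_zero_of_not_prime _ hp]
  rw [Rat.eq_iff_mul_eq_mul]
  have h1 : (a.num.natAbs : ℤ) = a.num := Int.natAbs_of_nonneg (Rat.num_pos.2 ha).le
  have h2 : (b.num.natAbs : ℤ) = b.num := Int.natAbs_of_nonneg (Rat.num_pos.2 hb).le
  rw [← h1, ← h2]
  exact_mod_cast key

/-- Product of the weights over a finite set of primes. -/
noncomputable def wtS (S : Finset ℕ) (a : ℚ) : ℝ := ∏ p ∈ S, wt (padicValRat p a)

lemma wtS_pos (S : Finset ℕ) (a : ℚ) : 0 < wtS S a := Finset.prod_pos fun _ _ => wt_pos _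

lemma prod_lower (S : Finset ℕ) (hS : ∀ p ∈ S, p.Prime) : ∀ A B : Finset ℚ,
    (∀ a ∈ A, 0 < a) → (∀ b ∈ B, 0 < b) →
    (∀ a ∈ A, ∀ a' ∈ A, ∀ p : ℕ, p.Prime → p ∉ S → padicValRat p a = padicValRat p a') →
    (∀ a ∈ B, ∀ a' ∈ B, ∀ p : ℕ, p.Prime → p ∉ S → padicValRat p a = padicValRat p a') →
    (∑ a ∈ A, wtS S a) * (∑ b ∈ B, wtS S b) ≤ ((A * B).card : ℝ) := by
  induction S using Finset.induction_on with
  | empty =>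
    intro A B hA hB hA' hB'
    have cA : A.card ≤ 1 := Finset.card_le_one.2 fun a ha b hb =>
      rat_eq_of_val a b (hA a ha) (hA b hb) fun p hp => hA' a ha b hb p hp (by simp)
    have cB : B.card ≤ 1 := Finset.card_le_one.2 fun a ha b hb =>
      rat_eq_of_val a b (hB a ha) (hB b hb) fun p hp => hB' a ha b hb p hp (by simp)
    simp only [wtS, Finset.prod_empty, Finset.sum_const, nsmul_eq_mul, mul_one]
    rcases A.eq_empty_or_nonempty with rfl | hAn
    · simp
    rcases B.eq_empty_or_nonempty with rfl | hBn
    · simp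
    have := (hAn.mul hBn).card_pos
    have h2 : A.card * B.card ≤ (A * B).card := by nlinarith
    exact_mod_cast h2
  | insert p S hpS ih =>
    intro A B hA hB hA' hB'
    have hp : p.Prime := hS p (Finset.mem_insert_self _ _)
    haveI : Fact p.Prime := ⟨hp⟩
    have ih := ih (fun q hq => hS q (Finset.mem_insert_of_mem hq))
    let v : ℚ → ℤ := fun a => padicValRat p a
    have split : ∀ A : Finset ℚ, ∑ a ∈ A, wtS (insert p S) a =
        ∑ i ∈ A.image v, wt i * ∑ a ∈ A with v a = i, wtS S a := by
      intro A
      rw [← Finset.sum_fiberwise_of_maps_to (g := v) (t := A.image v)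
        (fun a ha => Finset.mem_image_of_mem v ha)]
      refine Finset.sum_congr rfl fun i _ => ?_
      rw [Finset.mul_sum]
      refine Finset.sum_congr rfl fun a ha => ?_
      rw [Finset.mem_filter] at ha
      rw [wtS, Finset.prod_insert hpS, ← ha.2]; rfl
    have card_split : ((A * B).card : ℝ) =
        ∑ s ∈ A.image v + B.image v, (((A * B).filter (fun c => v c = s)).card : ℝ) := by
      rw [Finset.card_eq_sum_card_fiberwise (f := v) (t := A.image v + B.image v)]
      · push_cast; rfl
      · intro c hc
        obtain ⟨a, ha, b, hb, rfl⟩ := Finset.mem_mul.1 (Finset.mem_coe.1 hc)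
        have : v (a * b) = v a + v b := padicValRat.mul (hA a ha).ne' (hB b hb).ne'
        rw [this]
        exact Finset.mem_coe.2 (Finset.add_mem_add (Finset.mem_image_of_mem v ha) (Finset.mem_image_of_mem v hb))
    rw [split A, split B, card_split]
    apply one_dim
    · exact fun i => Finset.sum_nonneg fun a _ => (wtS_pos S a).le
    · exact fun i => Finset.sum_nonneg fun a _ => (wtS_pos S a).le
    · exact fun s => Nat.cast_nonneg _
    · intro i _ j _
      have fib : ∀ (A : Finset ℚ) (i : ℤ),
          (∀ a ∈ A, ∀ a' ∈ A, ∀ q : ℕ, q.Prime → q ∉ insert p S → padicValRat q a = padicValRat q a') →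
          (∀ a ∈ A.filter (fun a => v a = i), ∀ a' ∈ A.filter (fun a => v a = i),
            ∀ q : ℕ, q.Prime → q ∉ S → padicValRat q a = padicValRat q a') := by
        intro A i hA a ha a' ha' q hq hqS
        rw [Finset.mem_filter] at ha ha'
        by_cases hqp : q = p
        · subst hqp; exact ha.2.trans ha'.2.symm
        · exact hA a ha.1 a' ha'.1 q hq (by simp [hqp, hqS])
      refine (ih (A.filter (fun a => v a = i)) (B.filter (fun a => v a = j))
        (fun a ha => hA a (Finset.mem_filter.1 ha).1) (fun a ha => hB a (Finset.mem_filter.1 ha).1)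
        (fib A i hA') (fib B j hB')).trans ?_
      have hsub : A.filter (fun a => v a = i) * B.filter (fun a => v a = j) ⊆
          (A * B).filter (fun c => v c = i + j) := by
        intro c hc
        obtain ⟨a, ha, b, hb, rfl⟩ := Finset.mem_mul.1 hc
        rw [Finset.mem_filter] at ha hb ⊢
        refine ⟨Finset.mul_mem_mul ha.1 hb.1, ?_⟩
        rw [← ha.2, ← hb.2]
        exact padicValRat.mul (hA a ha.1).ne' (hB b hb.1).ne'
      exact_mod_cast Finset.card_le_card hsub

/-- Divisor-type bound. -/
lemma div_bound (S : Finset ℕ) (hS : ∀ p ∈ S, p.Prime) (n : ℕ) (hn : 1 ≤ n) (y t : ℝ)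
    (hy : Real.log n ≤ y) (hy3 : 3 ≤ y) (ht : 1 < t) :
    ∏ p ∈ S, ((n.factorization p : ℝ) + 1) ≤
      Real.exp ((t + 1) * (2 * Real.log y) + Real.log 2 * (y / Real.log t)) := by
  have hlt : 0 < Real.log t := Real.log_pos ht
  have hl2 : 0 < Real.log 2 := Real.log_pos (by norm_num)
  rw [← Finset.prod_filter_mul_prod_filter_not S (fun p : ℕ => (p : ℝ) ≤ t), Real.exp_add]
  have hdvd : ∀ T ⊆ S, ∏ p ∈ T, p ^ n.factorization p ≤ n := by
    intro T hT
    apply Nat.le_of_dvd hn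
    apply Finset.prod_dvd_of_isRelPrime
    · intro a ha b hb hab
      exact Nat.coprime_iff_isRelPrime.1
        (Nat.Coprime.pow _ _ ((Nat.coprime_primes (hS a (hT ha)) (hS b (hT hb))).2 hab))
    · intro p _; exact Nat.ordProj_dvd n p
  apply mul_le_mul
  · have hone : ∀ p ∈ S.filter (fun p : ℕ => (p : ℝ) ≤ t), (n.factorization p : ℝ) + 1 ≤ y ^ 2 := by
      intro p hp
      have hpp := hS p (Finset.mem_filter.1 hp).1
      have h1 : 2 ^ n.factorization p ≤ n :=
        (Nat.pow_le_pow_left hpp.two_le _).trans (Nat.ordProj_le p (by omega))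
      have h2 : (n.factorization p : ℝ) * Real.log 2 ≤ y := by
        refine le_trans ?_ hy
        rw [← Real.log_pow]
        exact Real.log_le_log (by positivity) (by exact_mod_cast h1)
      have := Real.log_two_gt_d9
      have hv : (0:ℝ) ≤ n.factorization p := Nat.cast_nonneg _
      nlinarith
    have hcard : ((S.filter (fun p : ℕ => (p : ℝ) ≤ t)).card : ℝ) ≤ t + 1 := by
      have : S.filter (fun p : ℕ => (p : ℝ) ≤ t) ⊆ Finset.range (⌊t⌋₊ + 1) := by
        intro p hp
        rw [Finset.mem_range, Nat.lt_succ_iff]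
        exact Nat.le_floor (Finset.mem_filter.1 hp).2
      have h := Finset.card_le_card this
      rw [Finset.card_range] at h
      have h' : ((S.filter (fun p : ℕ => (p : ℝ) ≤ t)).card : ℝ) ≤ ⌊t⌋₊ + 1 := by exact_mod_cast h
      linarith [Nat.floor_le (show 0 ≤ t by linarith)]
    have hly : 0 ≤ Real.log y := Real.log_nonneg (by linarith)
    calc _ ≤ ∏ p ∈ S.filter (fun p : ℕ => (p : ℝ) ≤ t), y ^ 2 :=
          Finset.prod_le_prod (fun _ _ => by positivity) hone
      _ = Real.exp ((S.filter (fun p : ℕ => (p : ℝ) ≤ t)).card * (2 * Real.log y)) := by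
          rw [Finset.prod_const, Real.exp_nat_mul]
          congr 1
          rw [show 2 * Real.log y = Real.log (y^2) by rw [Real.log_pow]; norm_num,
            Real.exp_log (by positivity)]
      _ ≤ _ := Real.exp_le_exp.2 (mul_le_mul_of_nonneg_right hcard (by positivity))
  · set T := S.filter (fun p : ℕ => ¬ (p : ℝ) ≤ t) with hT
    have h1 : (∑ p ∈ T, (n.factorization p : ℝ)) * Real.log t ≤ y := by
      refine le_trans ?_ hy
      have h2 : Real.log ((∏ p ∈ T, p ^ n.factorization p : ℕ) : ℝ) ≤ Real.log n := by
        apply Real.log_le_log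
        · exact_mod_cast Finset.prod_pos fun p hp => pow_pos (hS p (Finset.mem_filter.1 hp).1).pos _
        · exact_mod_cast hdvd T (Finset.filter_subset _ _)
      refine le_trans ?_ h2
      push_cast
      rw [Real.log_prod]
      · rw [Finset.sum_mul]
        refine Finset.sum_le_sum fun p hp => ?_
        rw [Real.log_pow]
        apply mul_le_mul_of_nonneg_left _ (Nat.cast_nonneg _)
        apply Real.log_le_log (by linarith)
        have := (Finset.mem_filter.1 hp).2
        linarith
      · intro p hp
        have := (hS p (Finset.mem_filter.1 hp).1).pos
        positivity
    have h3 : ∀ k : ℕ, (k : ℝ) + 1 ≤ Real.exp (Real.log 2 * k) := by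
      intro k
      rw [mul_comm, Real.exp_nat_mul, Real.exp_log (by norm_num)]
      exact_mod_cast (Nat.lt_two_pow_self (n := k))
    calc _ ≤ ∏ p ∈ T, Real.exp (Real.log 2 * n.factorization p) :=
          Finset.prod_le_prod (fun _ _ => by positivity) fun p _ => h3 _
      _ = Real.exp (Real.log 2 * ∑ p ∈ T, (n.factorization p : ℝ)) := by
          rw [← Real.exp_sum, Finset.mul_sum]
      _ ≤ _ := by
          apply Real.exp_le_exp.2
          apply mul_le_mul_of_nonneg_left _ hl2.le
          rw [le_div_iff₀ hlt]; exact h1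
  · exact Finset.prod_nonneg fun _ _ => by positivity
  · positivity

lemma wt_lower (S : Finset ℕ) (hS : ∀ p ∈ S, p.Prime) (q r : ℕ) (hq : 1 ≤ q) (hr : 1 ≤ r) (E : ℝ)
    (h1 : ∏ p ∈ S, ((q.factorization p : ℝ) + 1) ≤ Real.exp E)
    (h2 : ∏ p ∈ S, ((r.factorization p : ℝ) + 1) ≤ Real.exp E) :
    Real.exp (-(4 * E)) ≤ wtS S ((q : ℚ) / r) := by
  have h3 : ∀ p ∈ S, 1 / ((((q.factorization p : ℝ) + 1)) * ((r.factorization p : ℝ) + 1)) ^ 2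
      ≤ wt (padicValRat p ((q : ℚ) / r)) := by
    intro p hp
    haveI : Fact p.Prime := ⟨hS p hp⟩
    rw [padicValRat.div (by positivity) (by positivity), padicValRat.of_nat, padicValRat.of_nat,
      ← Nat.factorization_def _ (hS p hp), ← Nat.factorization_def _ (hS p hp)]
    unfold wt
    have h0 : (0:ℝ) ≤ (|(q.factorization p : ℤ) - r.factorization p| : ℤ) := by
      exact_mod_cast abs_nonneg _
    apply one_div_le_one_div_of_le (by positivity)
    apply pow_le_pow_left₀ (by positivity)
    push_cast
    have a1 : (0:ℝ) ≤ q.factorization p := Nat.cast_nonneg _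
    have a2 : (0:ℝ) ≤ r.factorization p := Nat.cast_nonneg _
    have : |(q.factorization p : ℝ) - r.factorization p| ≤ q.factorization p + r.factorization p :=
      abs_le.2 ⟨by linarith, by linarith⟩
    nlinarith
  refine le_trans ?_ (Finset.prod_le_prod (fun _ _ => by positivity) h3)
  rw [Finset.prod_div_distrib, Finset.prod_const_one, Finset.prod_pow, Finset.prod_mul_distrib,
    Real.exp_neg, ← one_div]
  apply one_div_le_one_div_of_le
  · exact pow_pos (mul_pos (Finset.prod_pos fun _ _ => by positivity)
      (Finset.prod_pos fun _ _ => by positivity)) _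
  · have e : Real.exp (4 * E) = (Real.exp E * Real.exp E) ^ 2 := by
      rw [← Real.exp_add, ← Real.exp_nat_mul]; congr 1; push_cast; ring
    rw [e]
    have n1 : 0 ≤ ∏ p ∈ S, ((q.factorization p : ℝ) + 1) := Finset.prod_nonneg fun _ _ => by positivity
    have n2 : 0 ≤ ∏ p ∈ S, ((r.factorization p : ℝ) + 1) := Finset.prod_nonneg fun _ _ => by positivity
    exact pow_le_pow_left₀ (mul_nonneg n1 n2) (mul_le_mul h1 h2 n2 (Real.exp_pos _).le) _

lemma numeric (l : ℝ) (hl : 2000 ≤ l) :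
    8 * ((Real.exp (l / 2) + 1) * (2 * l) + Real.log 2 * (Real.exp l / (l / 2)))
      ≤ 2 * (Real.exp l / Real.sqrt l) := by
  set s := Real.sqrt l with hs
  have hs2 : s ^ 2 = l := Real.sq_sqrt (by linarith)
  have hs0 : 0 < s := Real.sqrt_pos.2 (by linarith)
  have hs32 : 32 ≤ s := Real.le_sqrt_of_sq_le (by linarith)
  set X := Real.exp (l / 2) with hX
  have hXX : Real.exp l = X ^ 2 := by
    rw [hX, ← Real.exp_nat_mul]; congr 1; push_cast; ring
  have hX3 : (l / 2) ^ 3 / 6 ≤ X := by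
    have := Real.pow_div_factorial_le_exp (l / 2) (by linarith) 3
    simpa [Nat.factorial] using this
  have hX1 : 1 ≤ X := Real.one_le_exp (by linarith)
  have h1 : 32 * (l * s) ≤ X := by
    have : l * s ≤ l * l := by nlinarith
    nlinarith [mul_nonneg (mul_nonneg (show 0 ≤ l by linarith) (show 0 ≤ l by linarith)) (sub_nonneg.2 hl)]
  have h2 : 8 * ((X + 1) * (2 * l)) ≤ X ^ 2 / s := by
    rw [le_div_iff₀ hs0]
    have hls : 0 ≤ l * s := by positivity
    nlinarith
  have h3 : 8 * (Real.log 2 * (X ^ 2 / (l / 2))) ≤ X ^ 2 / s := by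
    have e : 8 * (Real.log 2 * (X ^ 2 / (l / 2))) = (16 * Real.log 2 / s) * (X ^ 2 / s) := by
      rw [← hs2]; field_simp; norm_num
    rw [e]
    apply mul_le_of_le_one_left (by positivity)
    rw [div_le_one hs0]
    linarith [Real.log_two_lt_d9]
  rw [hXX]
  linarith

/-- For every `ε > 0` there is `C` such that for `Q ≥ C` and `A, B ⊆ F_Q`,
`|AB| ≥ |A||B| exp(−(4√(log 2) + ε) log Q/√(log log Q))`. -/
theorem main_product (ε : ℝ) (hε : 0 < ε) :
    ∃ C : ℝ, ∀ Q : ℝ, 1 ≤ Q → C ≤ Q →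
      ∀ A B : Finset ℚ, ↑A ⊆ fareyQ Q → ↑B ⊆ fareyQ Q →
        (A.card : ℝ) * B.card *
            Real.exp (-(4 * Real.sqrt (Real.log 2) + ε) * Real.log Q /
              Real.sqrt (Real.log (Real.log Q)))
          ≤ ((A * B).card : ℝ) := by
  refine ⟨Real.exp (Real.exp 2000), fun Q hQ1 hQ A B hA hB => ?_⟩
  have hy : Real.exp 2000 ≤ Real.log Q := (Real.le_log_iff_exp_le (by linarith)).2 hQ
  set y := Real.log Q with hydef
  have hy0 : 0 < y := (Real.exp_pos _).trans_le hy
  have hl : 2000 ≤ Real.log y := (Real.le_log_iff_exp_le hy0).2 hy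
  have hy3 : 3 ≤ y := by linarith [Real.add_one_le_exp (2000:ℝ)]
  set l := Real.log y with hldef
  have hely : Real.exp l = y := Real.exp_log hy0
  set t := Real.exp (l / 2) with ht
  have ht1 : 1 < t := Real.one_lt_exp_iff.2 (by linarith)
  have hlogt : Real.log t = l / 2 := Real.log_exp _
  set E := (t + 1) * (2 * l) + Real.log 2 * (y / (l / 2)) with hE
  let S : Finset ℕ := (Finset.range (⌊Q⌋₊ + 1)).filter Nat.Prime
  have hS : ∀ p ∈ S, p.Prime := fun p hp => (Finset.mem_filter.1 hp).2
  have hdiv : ∀ q : ℕ, 1 ≤ q → (q : ℝ) ≤ Q →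
      ∏ p ∈ S, ((q.factorization p : ℝ) + 1) ≤ Real.exp E := by
    intro q hq hqQ
    have := div_bound S hS q hq y t
      (Real.log_le_log (by exact_mod_cast hq) hqQ) hy3 ht1
    rwa [hlogt] at this
  have hpos : ∀ A : Finset ℚ, ↑A ⊆ fareyQ Q → ∀ a ∈ A, 0 < a := by
    intro A hA a ha
    obtain ⟨q, r, hq, _, hr, _, rfl⟩ := hA (Finset.mem_coe.2 ha)
    positivity
  have hout : ∀ A : Finset ℚ, ↑A ⊆ fareyQ Q → ∀ a ∈ A, ∀ p : ℕ, p.Prime → p ∉ S →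
      padicValRat p a = 0 := by
    intro A hA a ha p hp hpS
    haveI : Fact p.Prime := ⟨hp⟩
    obtain ⟨q, r, hq, hqQ, hr, hrQ, rfl⟩ := hA (Finset.mem_coe.2 ha)
    have hbig : ⌊Q⌋₊ < p := by
      by_contra hcon
      exact hpS (Finset.mem_filter.2 ⟨Finset.mem_range.2 (by omega), hp⟩)
    have hz : ∀ m : ℕ, 1 ≤ m → (m : ℝ) ≤ Q → padicValNat p m = 0 := by
      intro m hm hmQ
      apply padicValNat.eq_zero_of_not_dvd
      intro hd
      have := Nat.le_of_dvd hm hd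
      have := Nat.le_floor hmQ
      omega
    rw [padicValRat.div (by positivity) (by positivity), padicValRat.of_nat, padicValRat.of_nat,
      hz q hq hqQ, hz r hr hrQ]
    simp
  have hlow : ∀ A : Finset ℚ, ↑A ⊆ fareyQ Q →
      (A.card : ℝ) * Real.exp (-(4 * E)) ≤ ∑ a ∈ A, wtS S a := by
    intro A hA
    rw [← nsmul_eq_mul]
    apply Finset.card_nsmul_le_sum
    intro a ha
    obtain ⟨q, r, hq, hqQ, hr, hrQ, rfl⟩ := hA (Finset.mem_coe.2 ha)
    exact wt_lower S hS q r hq hr E (hdiv q hq hqQ) (hdiv r hr hrQ)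
  have hmain := prod_lower S hS A B (hpos A hA) (hpos B hB)
    (fun a ha a' ha' p hp hpS => by rw [hout A hA a ha p hp hpS, hout A hA a' ha' p hp hpS])
    (fun a ha a' ha' p hp hpS => by rw [hout B hB a ha p hp hpS, hout B hB a' ha' p hp hpS])
  refine le_trans ?_ ((mul_le_mul (hlow A hA) (hlow B hB) (by positivity)
    (Finset.sum_nonneg fun a _ => (wtS_pos S a).le)).trans hmain)
  have hexp : Real.exp (-(4 * √(Real.log 2) + ε) * y / √l) ≤
      Real.exp (-(4 * E)) * Real.exp (-(4 * E)) := by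
    rw [← Real.exp_add, Real.exp_le_exp]
    have hnum := numeric l hl
    rw [hely] at hnum
    have hsq : (1:ℝ) / 2 ≤ √(Real.log 2) :=
      Real.le_sqrt_of_sq_le (by linarith [Real.log_two_gt_d9])
    have hyl : 0 ≤ y / √l := by positivity
    have e : -(4 * √(Real.log 2) + ε) * y / √l = -((4 * √(Real.log 2) + ε) * (y / √l)) := by ring
    rw [e]
    have : 2 * (y / √l) ≤ (4 * √(Real.log 2) + ε) * (y / √l) :=
      mul_le_mul_of_nonneg_right (by linarith) hyl
    linarith
  calc _ ≤ (A.card : ℝ) * B.card * (Real.exp (-(4 * E)) * Real.exp (-(4 * E))) :=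
        mul_le_mul_of_nonneg_left hexp (by positivity)
    _ = _ := by ring
end
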